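/- arXiv:1808.05013 — 5 statements merged into one kernel-verified Lean document; each statement's English description precedes it below -/
import Mathlib

section
/- Let κ, μ, r̂ > 0, m_d > 1 and r > 0. Set σ = r̂/√(2μ(1+κ)) and d = σ√(2μκ). Then the mixture of the κ-μ density conditioned on a dominant-component shadowing value against the unit-power inverse Nakagami-m density satisfies ∫₀^∞ (r^μ/(σ²(xd)^{μ−1})) e^{−(r²+x²d²)/(2σ²)} I_{μ−1}(xdr/σ²) · (2(m_d−1)^{m_d} x^{−2m_d−1} e^{−(m_d−1)/x²}/Γ(m_d)) dx = ∑_{i=0}^∞ (4[(m_d−1)κ]^{(m_d+i)/2} r^{2i+2μ−1} μ^{(3i+m_d)/2+μ} (1+κ)^{i+μ} / (r̂^{2i+2μ} i! Γ(m_d) Γ(i+μ))) · e^{−r²(1+κ)μ/r̂²} · K_{m_d−i}(2√((m_d−1)μκ)). -/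
open MeasureTheory Set

/-- Pochhammer (rising factorial) symbol `(a)_n = Γ(a+n)/Γ(a)`. -/
noncomputable def poch (a : ℝ) (n : ℕ) : ℝ := Real.Gamma (a + n) / Real.Gamma a

/-- Beta function `B(x,y) = Γ(x)Γ(y)/Γ(x+y)`. -/
noncomputable def betaFn (x y : ℝ) : ℝ := Real.Gamma x * Real.Gamma y / Real.Gamma (x + y)

/-- Modified Bessel function of the first kind of real order ν. -/
noncomputable def besselI (ν x : ℝ) : ℝ :=
  ∑' k : ℕ, (x / 2) ^ (ν + 2 * (k : ℝ)) / ((k.factorial : ℝ) * Real.Gamma (ν + (k : ℝ) + 1))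

/-- Modified Bessel function of the second kind of real order ν. -/
noncomputable def besselK (ν x : ℝ) : ℝ :=
  ∫ t in Ioi (0 : ℝ), Real.exp (-x * Real.cosh t) * Real.cosh (ν * t)

/-- Confluent hypergeometric function ₁F₁(a;b;z). -/
noncomputable def hyp1F1 (a b z : ℝ) : ℝ :=
  ∑' n : ℕ, poch a n * z ^ n / (poch b n * (n.factorial : ℝ))

/-- Gauss hypergeometric function ₂F₁(a,b;c;z). -/
noncomputable def hyp2F1 (a b c z : ℝ) : ℝ :=
  ∑' n : ℕ, poch a n * poch b n * z ^ n / (poch c n * (n.factorial : ℝ))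

/-- Tricomi confluent hypergeometric function U(a,b,z). -/
noncomputable def tricomiU (a b z : ℝ) : ℝ :=
  (1 / Real.Gamma a) *
    ∫ t in Ioi (0 : ℝ), Real.exp (-z * t) * t ^ (a - 1) * (1 + t) ^ (b - a - 1)

/-- Regularized generalized hypergeometric function ₃F̃₁(a₁,a₂,a₃;b;z). -/
noncomputable def hyp3F1reg (a₁ a₂ a₃ b z : ℝ) : ℝ :=
  ∑' n : ℕ, poch a₁ n * poch a₂ n * poch a₃ n * z ^ n /
    (Real.Gamma (b + n) * (n.factorial : ℝ))

/-- Regularized generalized hypergeometric function ₂F̃₂(a,b;c,d;z). -/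
noncomputable def hyp2F2reg (a b c d z : ℝ) : ℝ :=
  ∑' n : ℕ, poch a n * poch b n * z ^ n /
    (Real.Gamma (c + n) * Real.Gamma (d + n) * (n.factorial : ℝ))

/-- The function `x ^ s * exp (-a x² - M / x²)` is integrable on the positive half-line
for every real `s`. -/
theorem integrableOn_rpow_mul_exp_neg_sq_sub_div_sq {a M : ℝ} (ha : 0 < a) (hM : 0 < M) (s : ℝ) :
    IntegrableOn (fun x : ℝ => x ^ s * Real.exp (-a * x ^ 2 - M / x ^ 2)) (Ioi 0) := by
  obtain ⟨n, hn⟩ := exists_nat_gt (-1 - s)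
  have hn' : -1 < s + 2 * (n : ℝ) := by
    have : (0 : ℝ) ≤ n := n.cast_nonneg
    linarith
  refine ((integrableOn_rpow_mul_exp_neg_mul_sq ha hn').const_mul (n.factorial / M ^ n)).mono'
    (by fun_prop) ?_
  refine (ae_restrict_iff' measurableSet_Ioi).2 (.of_forall fun x (hx : 0 < x) => ?_)
  have hpow : x ^ (s + 2 * (n : ℝ)) = x ^ s * (x ^ 2) ^ n := by
    rw [Real.rpow_add hx, ← pow_mul, ← Real.rpow_natCast x (2 * n)]
    push_cast
    rfl
  have key : Real.exp (-(M / x ^ 2)) ≤ n.factorial / M ^ n * (x ^ 2) ^ n := by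
    have h := Real.pow_div_factorial_le_exp (M / x ^ 2) (by positivity) n
    rw [div_pow] at h
    rw [Real.exp_neg]
    refine (inv_anti₀ (by positivity) h).trans_eq ?_
    field_simp
  rw [Real.norm_of_nonneg (by positivity), sub_eq_add_neg, Real.exp_add, hpow]
  calc x ^ s * (Real.exp (-a * x ^ 2) * Real.exp (-(M / x ^ 2)))
      ≤ x ^ s * (Real.exp (-a * x ^ 2) * (n.factorial / M ^ n * (x ^ 2) ^ n)) := by gcongr
    _ = _ := by ring

/-- Whole-line form of the integral defining `besselK`. -/
theorem besselK_eq_half_integral {ν z : ℝ}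
    (h : Integrable fun t : ℝ => Real.exp (-z * Real.cosh t) * Real.exp (-ν * t)) :
    ∫ t : ℝ, Real.exp (-z * Real.cosh t) * Real.exp (-ν * t) = 2 * besselK ν z := by
  rw [← intervalIntegral.integral_Iic_add_Ioi (b := 0) h.integrableOn h.integrableOn,
    ← neg_zero, ← integral_comp_neg_Ioi, neg_zero, ← integral_add h.comp_neg.integrableOn
      h.integrableOn, besselK, ← integral_const_mul]
  congr 1
  ext t
  rw [Real.cosh_neg, Real.cosh_eq (ν * t), neg_mul_neg, neg_mul ν t]
  ring

/-- The integral representation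
`∫₀^∞ x ^ (-2ν-1) e^{-a x² - M / x²} dx = (a / M) ^ (ν / 2) K_ν (2 √(a M))`. -/
theorem integral_rpow_mul_exp_neg_sq_sub_div_sq {a M : ℝ} (ha : 0 < a) (hM : 0 < M) (ν : ℝ) :
    ∫ x in Ioi (0 : ℝ), x ^ (-2 * ν - 1) * Real.exp (-a * x ^ 2 - M / x ^ 2) =
      (a / M) ^ (ν / 2) * besselK ν (2 * Real.sqrt (a * M)) := by
  set L : ℝ := Real.log (M / a) / 4 with hL
  have hderiv : ∀ t ∈ (univ : Set ℝ),
      HasDerivWithinAt (fun t : ℝ => Real.exp (L + t / 2)) (Real.exp (L + t / 2) * (1 / 2)) univ t :=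
    fun t _ => (((hasDerivAt_id t).div_const 2).const_add L).exp.hasDerivWithinAt
  have hinj : InjOn (fun t : ℝ => Real.exp (L + t / 2)) univ := by
    intro s _ t _ h
    have := Real.exp_injective h
    linarith
  have himage : (fun t : ℝ => Real.exp (L + t / 2)) '' univ = Ioi 0 := by
    ext x
    refine ⟨?_, fun hx => ⟨2 * (Real.log x - L), trivial, ?_⟩⟩
    · rintro ⟨t, -, rfl⟩
      exact Real.exp_pos _
    · simp only
      rw [show L + 2 * (Real.log x - L) / 2 = Real.log x by ring, Real.exp_log hx]
  obtain ⟨α, rfl⟩ : ∃ α, a = Real.exp α := ⟨_, (Real.exp_log ha).symm⟩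
  obtain ⟨β, rfl⟩ : ∃ β, M = Real.exp β := ⟨_, (Real.exp_log hM).symm⟩
  have hLval : L = (β - α) / 4 := by rw [hL, ← Real.exp_sub, Real.log_exp]
  have hsqrt : Real.sqrt (Real.exp α * Real.exp β) = Real.exp ((α + β) / 2) := by
    rw [← Real.exp_add, Real.exp_half]
  have hcosh : ∀ t : ℝ, -Real.exp α * Real.exp (L + t / 2) ^ 2 - Real.exp β / Real.exp (L + t / 2) ^ 2
      = -(2 * Real.sqrt (Real.exp α * Real.exp β)) * Real.cosh t := by
    intro t
    rw [hsqrt, Real.cosh_eq, ← Real.exp_nat_mul, ← Real.exp_sub, neg_mul, ← Real.exp_add, hLval,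
      show α + ((2 : ℕ) : ℝ) * ((β - α) / 4 + t / 2) = (α + β) / 2 + t by push_cast; ring,
      show β - ((2 : ℕ) : ℝ) * ((β - α) / 4 + t / 2) = (α + β) / 2 + -t by push_cast; ring,
      Real.exp_add, Real.exp_add]
    ring
  have hcongr : ∀ t : ℝ, |Real.exp (L + t / 2) * (1 / 2)| •
      (Real.exp (L + t / 2) ^ (-2 * ν - 1) *
        Real.exp (-Real.exp α * Real.exp (L + t / 2) ^ 2 - Real.exp β / Real.exp (L + t / 2) ^ 2)) =
      Real.exp (-2 * ν * L) / 2 *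
        (Real.exp (-(2 * Real.sqrt (Real.exp α * Real.exp β)) * Real.cosh t) *
          Real.exp (-ν * t)) := by
    intro t
    rw [hcosh, abs_of_pos (by positivity), smul_eq_mul, ← Real.exp_mul,
      show (L + t / 2) * (-2 * ν - 1) = -2 * ν * L + -ν * t + -(L + t / 2) by ring,
      Real.exp_add (_ + _) (-(L + t / 2)), Real.exp_add (-2 * ν * L), Real.exp_neg (L + t / 2)]
    have := Real.exp_ne_zero (L + t / 2)
    generalize Real.exp (L + t / 2) = E at *
    field_simp
  have hint := integrableOn_rpow_mul_exp_neg_sq_sub_div_sq ha hM (-2 * ν - 1)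
  rw [← himage, integrableOn_image_iff_integrableOn_abs_deriv_smul .univ hderiv hinj,
    integrableOn_univ] at hint
  simp only [hcongr] at hint
  rw [← himage, integral_image_eq_integral_abs_deriv_smul .univ hderiv hinj, setIntegral_univ]
  simp only [hcongr]
  rw [integral_const_mul, besselK_eq_half_integral
    ((integrable_const_mul_iff (by simp) _).1 hint), hLval, ← Real.exp_sub, ← Real.exp_mul,
    show -2 * ν * ((β - α) / 4) = (α - β) * (ν / 2) by ring]
  ring

theorem summable_pow_div_Gamma_add {μ : ℝ} (hμ : 0 < μ) {C : ℝ} (hC : 0 < C) :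
    Summable fun i : ℕ => C ^ i / Real.Gamma (i + μ) := by
  have hpos : ∀ i : ℕ, 0 < Real.Gamma (i + μ) := fun i => Real.Gamma_pos_of_pos (by positivity)
  have hratio : ∀ i : ℕ, ‖C ^ (i + 1) / Real.Gamma ((i + 1 : ℕ) + μ)‖ /
      ‖C ^ i / Real.Gamma (i + μ)‖ = C / (i + μ) := by
    intro i
    have h1 : (i : ℝ) + μ ≠ 0 := by positivity
    have h2 := (hpos i).ne'
    rw [Real.norm_of_nonneg (div_nonneg (by positivity) (hpos _).le),
      Real.norm_of_nonneg (div_nonneg (by positivity) (hpos _).le), Nat.cast_succ,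
      add_right_comm, Real.Gamma_add_one h1]
    field_simp
    ring
  refine summable_of_ratio_test_tendsto_lt_one zero_lt_one
    (.of_forall fun i => (div_pos (by positivity) (hpos i)).ne') ?_
  simp only [hratio]
  exact (Filter.tendsto_atTop_add_const_right _ μ tendsto_natCast_atTop_atTop).const_div_atTop C

/-- Term-by-term integration of a Bessel-type series against `x ^ (-2m-1) e^{-a x² - M / x²}`. -/
theorem integral_tsum_pow_mul_exp_neg_sq_sub_div_sq {a M μ C : ℝ} (ha : 0 < a) (hM : 0 < M)
    (hμ : 0 < μ) (hC : 0 < C) (m : ℝ) :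
    ∫ x in Ioi (0 : ℝ), ∑' i : ℕ, C ^ i / (i.factorial * Real.Gamma (i + μ)) *
        (x ^ (-2 * (m - i) - 1) * Real.exp (-a * x ^ 2 - M / x ^ 2)) =
      ∑' i : ℕ, C ^ i / (i.factorial * Real.Gamma (i + μ)) *
        ((a / M) ^ ((m - i) / 2) * besselK (m - i) (2 * Real.sqrt (a * M))) := by
  obtain ⟨K, hK⟩ := (summable_pow_div_Gamma_add hμ
    (show 0 < C / (a / 2) by positivity)).tendsto_atTop_zero.bddAbove_range
  have hΓ : ∀ i : ℕ, 0 < Real.Gamma (i + μ) := fun i => Real.Gamma_pos_of_pos (by positivity)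
  have hK' : ∀ i : ℕ, C ^ i / Real.Gamma (i + μ) ≤ K * (a / 2) ^ i := by
    intro i
    have h : (C / (a / 2)) ^ i / Real.Gamma (i + μ) ≤ K := hK (mem_range_self i)
    rw [div_pow, div_right_comm, div_le_iff₀ (by positivity)] at h
    exact h
  have hpow : ∀ (i : ℕ) {x : ℝ}, 0 < x →
      x ^ (-2 * (m - i) - 1) = x ^ (-2 * m - 1) * (x ^ 2) ^ i := by
    intro i x hx
    rw [show -2 * (m - i) - 1 = (-2 * m - 1) + ((2 * i : ℕ) : ℝ) by push_cast; ring,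
      Real.rpow_add hx, Real.rpow_natCast, pow_mul]
  have hsum : ∀ x : ℝ, HasSum (fun i : ℕ => K * x ^ (-2 * m - 1) *
      Real.exp (-a * x ^ 2 - M / x ^ 2) * ((a / 2 * x ^ 2) ^ i / i.factorial))
      (K * (x ^ (-2 * m - 1) * Real.exp (-(a / 2) * x ^ 2 - M / x ^ 2))) := by
    intro x
    have h := (NormedSpace.expSeries_div_hasSum_exp (a / 2 * x ^ 2)).mul_left
      (K * x ^ (-2 * m - 1) * Real.exp (-a * x ^ 2 - M / x ^ 2))
    rwa [← Real.exp_eq_exp_ℝ, mul_assoc _ _ (Real.exp (a / 2 * x ^ 2)), ← Real.exp_add,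
      show -a * x ^ 2 - M / x ^ 2 + a / 2 * x ^ 2 = -(a / 2) * x ^ 2 - M / x ^ 2 by ring,
      mul_assoc K _ (Real.exp (-(a / 2) * x ^ 2 - M / x ^ 2))] at h
  have hle : ∀ (i : ℕ) {x : ℝ}, 0 < x → ‖C ^ i / (i.factorial * Real.Gamma (i + μ)) *
      (x ^ (-2 * (m - i) - 1) * Real.exp (-a * x ^ 2 - M / x ^ 2))‖ ≤ K * x ^ (-2 * m - 1) *
      Real.exp (-a * x ^ 2 - M / x ^ 2) * ((a / 2 * x ^ 2) ^ i / i.factorial) := by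
    intro i x hx
    have := hΓ i
    rw [Real.norm_of_nonneg (by positivity), hpow i hx]
    calc _ = C ^ i / Real.Gamma (i + μ) * (x ^ (-2 * m - 1) * (x ^ 2) ^ i *
            Real.exp (-a * x ^ 2 - M / x ^ 2) / i.factorial) := by field_simp
      _ ≤ K * (a / 2) ^ i * (x ^ (-2 * m - 1) * (x ^ 2) ^ i *
            Real.exp (-a * x ^ 2 - M / x ^ 2) / i.factorial) := by
        gcongr
        exact hK' i
      _ = _ := by rw [mul_pow]; ring
  have hres := hasSum_integral_of_dominated_convergence (μ := volume.restrict (Ioi (0 : ℝ)))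
    (F := fun (i : ℕ) (x : ℝ) => C ^ i / (i.factorial * Real.Gamma (i + μ)) *
      (x ^ (-2 * (m - i) - 1) * Real.exp (-a * x ^ 2 - M / x ^ 2)))
    (f := fun x => ∑' i : ℕ, C ^ i / (i.factorial * Real.Gamma (i + μ)) *
      (x ^ (-2 * (m - i) - 1) * Real.exp (-a * x ^ 2 - M / x ^ 2)))
    (fun i x => K * x ^ (-2 * m - 1) *
      Real.exp (-a * x ^ 2 - M / x ^ 2) * ((a / 2 * x ^ 2) ^ i / i.factorial))
    (fun i => by fun_prop)
    (fun i => (ae_restrict_iff' measurableSet_Ioi).2 (.of_forall fun x hx => hle i hx))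
    (.of_forall fun x => (hsum x).summable)
    (by
      simp only [(hsum _).tsum_eq]
      exact (integrableOn_rpow_mul_exp_neg_sq_sub_div_sq (half_pos ha) hM _).const_mul K)
    ((ae_restrict_iff' measurableSet_Ioi).2 (.of_forall fun x hx =>
      (Summable.of_norm_bounded (hsum x).summable fun i => hle i hx).hasSum))
  rw [← hres.tsum_eq]
  simp only [integral_const_mul, integral_rpow_mul_exp_neg_sq_sub_div_sq ha hM]

/-- Separation of variables in the `i`-th term of the conditional density times the shadowing
density. -/
theorem conditional_density_term_powers {r σ d x : ℝ} (hr : 0 < r) (hσ : 0 < σ) (hd : 0 < d)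
    (hx : 0 < x) (μ m : ℝ) (i : ℕ) :
    r ^ μ / (σ ^ 2 * (x * d) ^ (μ - 1)) * (x * d * r / σ ^ 2 / 2) ^ (μ - 1 + 2 * (i : ℝ)) *
        x ^ (-2 * m - 1) =
      r ^ (2 * μ - 1) / σ ^ 2 * (2 * σ ^ 2) ^ (1 - μ) * ((d * r / (2 * σ ^ 2)) ^ 2) ^ i *
        x ^ (-2 * (m - i) - 1) := by
  obtain ⟨r, rfl⟩ : ∃ t, r = Real.exp t := ⟨_, (Real.exp_log hr).symm⟩
  obtain ⟨σ, rfl⟩ : ∃ t, σ = Real.exp t := ⟨_, (Real.exp_log hσ).symm⟩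
  obtain ⟨d, rfl⟩ : ∃ t, d = Real.exp t := ⟨_, (Real.exp_log hd).symm⟩
  obtain ⟨x, rfl⟩ : ∃ t, x = Real.exp t := ⟨_, (Real.exp_log hx).symm⟩
  have hcast : ((2 : ℕ) : ℝ) = 2 := Nat.cast_two
  have h2 : ∀ y : ℝ, 2 * Real.exp y = Real.exp (Real.log 2 + y) := fun y => by
    rw [Real.exp_add, Real.exp_log two_pos]
  have h2' : ∀ y : ℝ, Real.exp y / 2 = Real.exp (y - Real.log 2) := fun y => by
    rw [Real.exp_sub, Real.exp_log two_pos]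
  simp only [← Real.exp_nat_mul, ← Real.exp_add, ← Real.exp_sub, ← Real.exp_mul, h2, h2', hcast]
  congr 1
  ring

/-- Simplification of the coefficient of the `i`-th Bessel function; `b` is the base and `μ` the
exponent parameter. -/
theorem shadowed_coefficient_powers {r rhat κ b q M σ d : ℝ} (hr : 0 < r) (hrhat : 0 < rhat)
    (hκ : 0 < κ) (hb : 0 < b) (hq : 0 < q) (hM : 0 < M) (hσ : σ = rhat / Real.sqrt (2 * b * q))
    (hd : d = σ * Real.sqrt (2 * b * κ)) (μ m : ℝ) (i : ℕ) :
    r ^ (2 * μ - 1) / σ ^ 2 * (2 * σ ^ 2) ^ (1 - μ) * (2 * M ^ m) *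
        ((d * r / (2 * σ ^ 2)) ^ 2) ^ i * (b * κ / M) ^ ((m - i) / 2) =
      4 * (M * κ) ^ ((m + (i : ℝ)) / 2) * r ^ (2 * (i : ℝ) + 2 * μ - 1) *
        b ^ ((3 * (i : ℝ) + m) / 2 + μ) * q ^ ((i : ℝ) + μ) / rhat ^ (2 * (i : ℝ) + 2 * μ) := by
  subst hd hσ
  obtain ⟨r, rfl⟩ : ∃ t, r = Real.exp t := ⟨_, (Real.exp_log hr).symm⟩
  obtain ⟨s, rfl⟩ : ∃ t, rhat = Real.exp t := ⟨_, (Real.exp_log hrhat).symm⟩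
  obtain ⟨κ, rfl⟩ : ∃ t, κ = Real.exp t := ⟨_, (Real.exp_log hκ).symm⟩
  obtain ⟨b, rfl⟩ : ∃ t, b = Real.exp t := ⟨_, (Real.exp_log hb).symm⟩
  obtain ⟨q, rfl⟩ : ∃ t, q = Real.exp t := ⟨_, (Real.exp_log hq).symm⟩
  obtain ⟨M, rfl⟩ : ∃ t, M = Real.exp t := ⟨_, (Real.exp_log hM).symm⟩
  have hcast : ((2 : ℕ) : ℝ) = 2 := Nat.cast_two
  have h2 : ∀ y : ℝ, 2 * Real.exp y = Real.exp (Real.log 2 + y) := fun y => by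
    rw [Real.exp_add, Real.exp_log two_pos]
  have h4 : ∀ y : ℝ, 4 * Real.exp y = Real.exp (2 * Real.log 2 + y) := fun y => by
    rw [two_mul, add_assoc, Real.exp_add, Real.exp_add, Real.exp_log two_pos]
    ring
  simp only [← Real.exp_nat_mul, ← Real.exp_add, ← Real.exp_sub, ← Real.exp_mul, h2, h4, hcast,
    ← Real.exp_half]
  congr 1
  ring

/-- Theorem 1: PDF of the single shadowed κ-μ Type I model with
inverse Nakagami-m shadowing of the dominant component. -/
theorem single_shadowed_typeI_inverse_nakagami_pdf
    (κ μ rhat md r σ d : ℝ)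
    (hκ : 0 < κ) (hμ : 0 < μ) (hrhat : 0 < rhat) (hmd : 1 < md) (hr : 0 < r)
    (hσ : σ = rhat / Real.sqrt (2 * μ * (1 + κ)))
    (hd : d = σ * Real.sqrt (2 * μ * κ)) :
    (∫ x in Ioi (0 : ℝ),
      (r ^ μ / (σ ^ 2 * (x * d) ^ (μ - 1))) *
        Real.exp (-(r ^ 2 + x ^ 2 * d ^ 2) / (2 * σ ^ 2)) *
        besselI (μ - 1) (x * d * r / σ ^ 2) *
        (2 * (md - 1) ^ md * x ^ (-2 * md - 1) *
          Real.exp (-(md - 1) / x ^ 2) / Real.Gamma md)) =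
    ∑' i : ℕ,
      (4 * ((md - 1) * κ) ^ ((md + (i : ℝ)) / 2) * r ^ (2 * (i : ℝ) + 2 * μ - 1) *
          μ ^ ((3 * (i : ℝ) + md) / 2 + μ) * (1 + κ) ^ ((i : ℝ) + μ) /
          (rhat ^ (2 * (i : ℝ) + 2 * μ) * (i.factorial : ℝ) * Real.Gamma md *
            Real.Gamma ((i : ℝ) + μ))) *
        Real.exp (-(r ^ 2) * (1 + κ) * μ / rhat ^ 2) *
        besselK (md - (i : ℝ)) (2 * Real.sqrt ((md - 1) * μ * κ)) := by
  have hM : 0 < md - 1 := sub_pos.2 hmd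
  have hq : 0 < 1 + κ := by positivity
  have hσ0 : 0 < σ := by rw [hσ]; positivity
  have hd0 : 0 < d := by rw [hd]; positivity
  have hσsq : 2 * σ ^ 2 = rhat ^ 2 / (μ * (1 + κ)) := by
    rw [hσ, div_pow, Real.sq_sqrt (by positivity)]
    field_simp
  have hdsq : d ^ 2 = 2 * σ ^ 2 * (μ * κ) := by
    rw [hd, mul_pow, Real.sq_sqrt (by positivity)]
    ring
  set E : ℝ := Real.exp (-(r ^ 2) * (1 + κ) * μ / rhat ^ 2) with hE
  have hexp : ∀ x : ℝ, 0 < x → Real.exp (-(r ^ 2 + x ^ 2 * d ^ 2) / (2 * σ ^ 2)) *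
      Real.exp (-(md - 1) / x ^ 2) = E * Real.exp (-(μ * κ) * x ^ 2 - (md - 1) / x ^ 2) := by
    intro x hx
    rw [hE, ← Real.exp_add, ← Real.exp_add, hdsq, hσsq]
    congr 1
    field_simp
    ring
  set A : ℝ := r ^ (2 * μ - 1) / σ ^ 2 * (2 * σ ^ 2) ^ (1 - μ) * (2 * (md - 1) ^ md) * E /
    Real.Gamma md with hA
  have hintegrand : ∀ x ∈ Ioi (0 : ℝ),
      (r ^ μ / (σ ^ 2 * (x * d) ^ (μ - 1))) *
        Real.exp (-(r ^ 2 + x ^ 2 * d ^ 2) / (2 * σ ^ 2)) *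
        besselI (μ - 1) (x * d * r / σ ^ 2) *
        (2 * (md - 1) ^ md * x ^ (-2 * md - 1) *
          Real.exp (-(md - 1) / x ^ 2) / Real.Gamma md) =
      A * ∑' i : ℕ, ((d * r / (2 * σ ^ 2)) ^ 2) ^ i / (i.factorial * Real.Gamma (i + μ)) *
        (x ^ (-2 * (md - i) - 1) * Real.exp (-(μ * κ) * x ^ 2 - (md - 1) / x ^ 2)) := by
    intro x hx
    rw [besselI, ← tsum_mul_left, ← tsum_mul_right, ← tsum_mul_left]
    refine tsum_congr fun i => ?_
    rw [show μ - 1 + (i : ℝ) + 1 = i + μ by ring]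
    have hpow := conditional_density_term_powers hr hσ0 hd0 hx μ md i
    calc _ = (r ^ μ / (σ ^ 2 * (x * d) ^ (μ - 1)) *
            (x * d * r / σ ^ 2 / 2) ^ (μ - 1 + 2 * (i : ℝ)) * x ^ (-2 * md - 1)) *
          (Real.exp (-(r ^ 2 + x ^ 2 * d ^ 2) / (2 * σ ^ 2)) * Real.exp (-(md - 1) / x ^ 2)) *
          (2 * (md - 1) ^ md / Real.Gamma md / (i.factorial * Real.Gamma (i + μ))) := by ring
      _ = _ := by
        rw [hpow, hexp x hx, hA]
        ring
  rw [setIntegral_congr_fun measurableSet_Ioi hintegrand, integral_const_mul,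
    integral_tsum_pow_mul_exp_neg_sq_sub_div_sq (by positivity) hM hμ (by positivity),
    ← tsum_mul_left]
  refine tsum_congr fun i => ?_
  have hcoeff := shadowed_coefficient_powers hr hrhat hκ hμ hq hM hσ hd μ md i
  rw [show μ * κ * (md - 1) = (md - 1) * μ * κ by ring]
  calc _ = (r ^ (2 * μ - 1) / σ ^ 2 * (2 * σ ^ 2) ^ (1 - μ) * (2 * (md - 1) ^ md) *
        ((d * r / (2 * σ ^ 2)) ^ 2) ^ i * (μ * κ / (md - 1)) ^ ((md - i) / 2)) *
        (E / (i.factorial * Real.Gamma md * Real.Gamma (i + μ)) *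
          besselK (md - i) (2 * Real.sqrt ((md - 1) * μ * κ))) := by rw [hA]; ring
    _ = _ := by
      rw [hcoeff]
      ring
end

section
/- Let κ, μ, m_s, r̂ > 0 and r > 0. Set σ = r̂/√(2μ(1+κ)) and d = σ√(2μκ). Then the mixture of the κ-μ density conditioned on a scattered-component shadowing value against the unit-power Nakagami-m density satisfies ∫₀^∞ (r^μ/(σ²x²d^{μ−1})) e^{−(r²+d²)/(2σ²x²)} I_{μ−1}(dr/(σ²x²)) · (2 m_s^{m_s} x^{2m_s−1} e^{−m_s x²}/Γ(m_s)) dx = ∑_{i=0}^∞ (4(m_s μ)^{(2i+m_s+μ)/2} r^{2i+2μ−1} κ^i (1+κ)^{i+μ} / (i! Γ(m_s) Γ(i+μ) (r²(1+κ)+r̂²κ)^{(2i−m_s+μ)/2} r̂^{m_s+μ})) · K_{2i−m_s+μ}(2√(m_s μ (r²(1+κ)+r̂²κ))/r̂). -/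
open MeasureTheory Set

lemma integrable_exp_neg_mul_cosh_mul_exp {z : ℝ} (hz : 0 < z) (ν : ℝ) :
    Integrable fun u : ℝ => Real.exp (-z * Real.cosh u) * Real.exp (ν * u) := by
  have hg : Integrable fun u : ℝ => Real.exp (ν ^ 2 / z) * Real.exp (-(z / 4) * u ^ 2) :=
    (integrable_exp_neg_mul_sq (by positivity)).const_mul _
  refine hg.mono' (by fun_prop) (.of_forall fun u => ?_)
  rw [Real.norm_of_nonneg (by positivity), ← Real.exp_add, ← Real.exp_add, Real.exp_le_exp]
  have hcosh : u ^ 2 / 2 ≤ Real.cosh u := by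
    have hsinh : (u / 2) ^ 2 ≤ Real.sinh (u / 2) ^ 2 := by
      rw [sq_le_sq, Real.abs_sinh]
      exact Real.self_le_sinh_iff.2 (abs_nonneg _)
    have hdouble := Real.cosh_two_mul (u / 2)
    rw [mul_div_cancel₀ u two_ne_zero, Real.cosh_sq] at hdouble
    linarith
  have hsq : 0 ≤ (z * u / 2 - ν) ^ 2 / z := by positivity
  have hexpand : (z * u / 2 - ν) ^ 2 / z = z * u ^ 2 / 4 - ν * u + ν ^ 2 / z := by
    field_simp
    ring
  nlinarith [mul_le_mul_of_nonneg_left hcosh hz.le]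

lemma integral_exp_neg_mul_cosh_mul_exp {z : ℝ} (hz : 0 < z) (ν : ℝ) :
    ∫ u : ℝ, Real.exp (-z * Real.cosh u) * Real.exp (ν * u) = 2 * besselK ν z := by
  have hreflect : ∫ u : ℝ, Real.exp (-z * Real.cosh u) * Real.exp (-ν * u) =
      ∫ u : ℝ, Real.exp (-z * Real.cosh u) * Real.exp (ν * u) := by
    rw [← integral_neg_eq_self]
    simp
  have heven : ∫ u : ℝ, Real.exp (-z * Real.cosh u) * Real.cosh (ν * u) = 2 * besselK ν z := by
    rw [besselK, ← integral_comp_abs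
      (f := fun u => Real.exp (-z * Real.cosh u) * Real.cosh (ν * u))]
    congr 1 with u
    rcases abs_cases u with ⟨h, -⟩ | ⟨h, -⟩ <;> simp [h]
  have hadd := integral_add (integrable_exp_neg_mul_cosh_mul_exp hz ν)
    (integrable_exp_neg_mul_cosh_mul_exp hz (-ν))
  rw [hreflect] at hadd
  have hcosh : ∫ u : ℝ, (Real.exp (-z * Real.cosh u) * Real.exp (ν * u) +
      Real.exp (-z * Real.cosh u) * Real.exp (-ν * u)) =
      2 * ∫ u : ℝ, Real.exp (-z * Real.cosh u) * Real.cosh (ν * u) := by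
    rw [← integral_const_mul]
    congr 1 with u
    rw [Real.cosh_eq (ν * u), neg_mul ν u]
    ring
  linarith

/-- The integral `∫₀^∞ x^{-2ν-1} e^{-A/x²-mx²} dx` in terms of `K_ν`. -/
lemma integrableOn_and_integral_rpow_mul_exp_neg_inv_sq_sub_sq {A m : ℝ} (hA : 0 < A) (hm : 0 < m)
    (ν : ℝ) :
    IntegrableOn (fun x : ℝ => x ^ (-2 * ν - 1) * Real.exp (-A / x ^ 2 - m * x ^ 2)) (Ioi 0) ∧
    ∫ x in Ioi (0 : ℝ), x ^ (-2 * ν - 1) * Real.exp (-A / x ^ 2 - m * x ^ 2) =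
      (m / A) ^ (ν / 2) * besselK ν (2 * Real.sqrt (A * m)) := by
  obtain ⟨α, rfl⟩ : ∃ α, A = Real.exp α := ⟨_, (Real.exp_log hA).symm⟩
  obtain ⟨β, rfl⟩ : ∃ β, m = Real.exp β := ⟨_, (Real.exp_log hm).symm⟩
  set φ : ℝ → ℝ := fun u => Real.exp ((α - β) / 4 - u / 2) with hφ
  have himage : φ '' univ = Ioi 0 := by
    ext x
    simp only [image_univ, mem_range, mem_Ioi]
    constructor
    · rintro ⟨u, rfl⟩
      exact Real.exp_pos _
    · intro hx
      refine ⟨(α - β) / 2 - 2 * Real.log x, ?_⟩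
      rw [hφ]
      ring_nf
      exact Real.exp_log hx
  have hinj : InjOn φ univ := fun u _ v _ h => by
    have := Real.exp_injective h
    linarith
  have hderiv : ∀ u ∈ univ, HasDerivWithinAt φ (φ u * (-(1 / 2))) univ u := fun u _ =>
    ((((hasDerivAt_id u).div_const 2).const_sub ((α - β) / 4)).exp).hasDerivWithinAt
  have hsqrt : Real.sqrt (Real.exp α * Real.exp β) = Real.exp ((α + β) / 2) := by
    rw [← Real.exp_add, Real.exp_half]
  set z := 2 * Real.exp ((α + β) / 2) with hz
  have hpullback : ∀ u, |φ u * (-(1 / 2))| • ((φ u) ^ (-2 * ν - 1) *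
      Real.exp (-Real.exp α / φ u ^ 2 - Real.exp β * φ u ^ 2)) =
      Real.exp ((β - α) * ν / 2) / 2 * (Real.exp (-z * Real.cosh u) * Real.exp (ν * u)) := by
    intro u
    have hinv : -Real.exp α / φ u ^ 2 = -Real.exp ((α + β) / 2) * Real.exp u := by
      rw [neg_div, neg_mul, ← Real.exp_add, hφ, ← Real.exp_nat_mul, ← Real.exp_sub]
      congr 2
      push_cast
      ring
    have hmul : Real.exp β * φ u ^ 2 = Real.exp ((α + β) / 2) * Real.exp (-u) := by
      rw [← Real.exp_add, hφ, ← Real.exp_nat_mul, ← Real.exp_add]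
      congr 1
      push_cast
      ring
    have hpow : φ u * (φ u) ^ (-2 * ν - 1) = Real.exp ((β - α) * ν / 2) * Real.exp (ν * u) := by
      rw [hφ, ← Real.exp_mul, ← Real.exp_add, ← Real.exp_add]
      congr 1
      ring
    have habs : |φ u * (-(1 / 2))| = φ u / 2 := by
      rw [abs_mul, abs_of_pos (Real.exp_pos _)]
      norm_num
      ring
    have hcosh : -Real.exp ((α + β) / 2) * Real.exp u - Real.exp ((α + β) / 2) * Real.exp (-u) =
        -z * Real.cosh u := by
      rw [Real.cosh_eq, hz]
      ring
    rw [habs, hinv, hmul, hcosh, smul_eq_mul]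
    linear_combination Real.exp (-z * Real.cosh u) / 2 * hpow
  have hzpos : 0 < z := by positivity
  constructor
  · rw [← himage, integrableOn_image_iff_integrableOn_abs_deriv_smul MeasurableSet.univ hderiv hinj,
      integrableOn_univ]
    simp_rw [hpullback]
    exact (integrable_exp_neg_mul_cosh_mul_exp hzpos ν).const_mul _
  · rw [← himage, integral_image_eq_integral_abs_deriv_smul MeasurableSet.univ hderiv hinj,
      setIntegral_univ]
    simp_rw [hpullback]
    rw [integral_const_mul, integral_exp_neg_mul_cosh_mul_exp hzpos, hsqrt, ← Real.exp_sub,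
      ← Real.exp_mul, ← hz]
    ring_nf

/-- The power series of `I_ν` has summable terms. -/
lemma summable_besselI {ν x : ℝ} (hν : -1 < ν) (hx : 0 < x) :
    Summable fun k : ℕ =>
      (x / 2) ^ (ν + 2 * (k : ℝ)) / ((k.factorial : ℝ) * Real.Gamma (ν + (k : ℝ) + 1)) := by
  have hpos : ∀ k : ℕ, 0 < Real.Gamma (ν + (k : ℝ) + 1) := fun k =>
    Real.Gamma_pos_of_pos (by have : (0 : ℝ) ≤ k := k.cast_nonneg; linarith)
  obtain ⟨c, hc, hle⟩ : ∃ c > 0, ∀ k : ℕ, c ≤ Real.Gamma (ν + (k : ℝ) + 1) := by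
    refine ⟨min (Real.Gamma (ν + (0 : ℕ) + 1)) (Real.Gamma (ν + (1 : ℕ) + 1)),
      lt_min (hpos 0) (hpos 1), fun k => ?_⟩
    rcases k with _ | k
    · exact min_le_left _ _
    · induction k with
      | zero => exact min_le_right _ _
      | succ k ih =>
        refine ih.trans ?_
        have hk : (0 : ℝ) ≤ k := k.cast_nonneg
        have hrec := Real.Gamma_add_one (s := ν + ((k + 1 : ℕ) : ℝ) + 1)
          (by push_cast; linarith)
        have harg : ν + ((k + 1 + 1 : ℕ) : ℝ) + 1 = ν + ((k + 1 : ℕ) : ℝ) + 1 + 1 := by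
          push_cast
          ring
        rw [harg, hrec]
        refine le_mul_of_one_le_left (hpos _).le ?_
        push_cast
        linarith
  refine .of_nonneg_of_le (fun k => ?_) (fun k => ?_)
    ((Real.summable_pow_div_factorial ((x / 2) ^ 2)).mul_left ((x / 2) ^ ν / c))
  · have := hpos k
    positivity
  · have hpow : (x / 2) ^ (ν + 2 * (k : ℝ)) = (x / 2) ^ ν * ((x / 2) ^ 2) ^ k := by
      rw [Real.rpow_add (by positivity), ← pow_mul, ← Real.rpow_natCast]
      push_cast
      rfl
    rw [hpow, div_mul_div_comm, mul_comm c]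
    gcongr
    exact hle k

/-- Termwise integration of a series of nonnegative functions; both sides are `0` when the
series of integrals diverges. -/
lemma setIntegral_tsum_of_nonneg {s : Set ℝ} (hs : MeasurableSet s) {f : ℕ → ℝ → ℝ}
    (hf : ∀ i, IntegrableOn (f i) s) (hnonneg : ∀ i, ∀ x ∈ s, 0 ≤ f i x)
    (hsum : ∀ x ∈ s, Summable fun i => f i x) :
    ∫ x in s, ∑' i, f i x = ∑' i, ∫ x in s, f i x := by
  have hmeas : ∀ i, AEMeasurable (fun x => ENNReal.ofReal (f i x)) (volume.restrict s) :=
    fun i => (hf i).aemeasurable.ennreal_ofReal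
  have hpoint : ∀ x ∈ s, ∑' i, f i x = (∑' i, ENNReal.ofReal (f i x)).toReal := fun x hx => by
    rw [← ENNReal.ofReal_tsum_of_nonneg (fun i => hnonneg i x hx) (hsum x hx),
      ENNReal.toReal_ofReal (tsum_nonneg fun i => hnonneg i x hx)]
  rw [setIntegral_congr_fun hs hpoint, integral_toReal (.tsum hmeas),
    lintegral_tsum hmeas, ENNReal.tsum_toReal_eq]
  · refine tsum_congr fun i => ?_
    rw [integral_eq_lintegral_of_nonneg_ae _ (hf i).aestronglyMeasurable]
    exact (ae_restrict_mem hs).mono (hnonneg i)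
  · exact fun i => (hf i).lintegral_lt_top.ne
  · refine (ae_restrict_mem hs).mono fun x hx => ?_
    rw [← ENNReal.ofReal_tsum_of_nonneg (fun i => hnonneg i x hx) (hsum x hx)]
    exact ENNReal.ofReal_lt_top

lemma typeII_integrand_term {κ μ ms rhat r σ d x : ℝ} (hκ : 0 < κ) (hμ : 0 < μ)
    (hrhat : 0 < rhat) (hr : 0 < r) (hσ : σ = rhat / Real.sqrt (2 * μ * (1 + κ)))
    (hd : d = σ * Real.sqrt (2 * μ * κ)) (hx : 0 < x) (i : ℕ) :
    (r ^ μ / (σ ^ 2 * x ^ 2 * d ^ (μ - 1))) *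
        Real.exp (-(r ^ 2 + d ^ 2) / (2 * σ ^ 2 * x ^ 2)) *
        ((d * r / (σ ^ 2 * x ^ 2) / 2) ^ (μ - 1 + 2 * (i : ℝ)) /
          ((i.factorial : ℝ) * Real.Gamma (μ - 1 + (i : ℝ) + 1))) *
        (2 * ms ^ ms * x ^ (2 * ms - 1) * Real.exp (-ms * x ^ 2) / Real.Gamma ms) =
      2 * ms ^ ms / ((i.factorial : ℝ) * Real.Gamma ms * Real.Gamma ((i : ℝ) + μ)) *
        (r ^ (2 * (i : ℝ) + 2 * μ - 1) * d ^ (2 * i) * 2 ^ (1 - μ - 2 * (i : ℝ)) *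
          σ ^ (-2 * μ - 4 * (i : ℝ))) *
        (x ^ (-2 * (2 * (i : ℝ) - ms + μ) - 1) *
          Real.exp (-(μ * (r ^ 2 * (1 + κ) + rhat ^ 2 * κ) / rhat ^ 2) / x ^ 2 - ms * x ^ 2)) := by
  have hσpos : 0 < σ := by rw [hσ]; positivity
  have hdpos : 0 < d := by rw [hd]; positivity
  have hσsq : σ ^ 2 = rhat ^ 2 / (2 * μ * (1 + κ)) := by
    rw [hσ, div_pow, Real.sq_sqrt (by positivity)]
  have hdsq : d ^ 2 = rhat ^ 2 * κ / (1 + κ) := by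
    rw [hd, mul_pow, Real.sq_sqrt (by positivity), hσsq]
    field_simp
  have hexp : Real.exp (-(r ^ 2 + d ^ 2) / (2 * σ ^ 2 * x ^ 2)) * Real.exp (-ms * x ^ 2) =
      Real.exp (-(μ * (r ^ 2 * (1 + κ) + rhat ^ 2 * κ) / rhat ^ 2) / x ^ 2 - ms * x ^ 2) := by
    rw [← Real.exp_add, hσsq, hdsq]
    congr 1
    field_simp
    ring
  have hpow : r ^ μ / (σ ^ 2 * x ^ 2 * d ^ (μ - 1)) *
      (d * r / (σ ^ 2 * x ^ 2) / 2) ^ (μ - 1 + 2 * (i : ℝ)) * x ^ (2 * ms - 1) =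
      r ^ (2 * (i : ℝ) + 2 * μ - 1) * d ^ (2 * i) * 2 ^ (1 - μ - 2 * (i : ℝ)) *
          σ ^ (-2 * μ - 4 * (i : ℝ)) * x ^ (-2 * (2 * (i : ℝ) - ms + μ) - 1) := by
    refine Real.log_injOn_pos (mem_Ioi.2 (by positivity)) (mem_Ioi.2 (by positivity)) ?_
    simp (disch := positivity) only [Real.log_mul, Real.log_div, Real.log_rpow, Real.log_pow]
    push_cast
    ring
  rw [← hexp, show μ - 1 + (i : ℝ) + 1 = i + μ by ring]
  linear_combination 2 * ms ^ ms / ((i.factorial : ℝ) * Real.Gamma ms * Real.Gamma ((i : ℝ) + μ)) *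
    (Real.exp (-(r ^ 2 + d ^ 2) / (2 * σ ^ 2 * x ^ 2)) * Real.exp (-ms * x ^ 2)) * hpow

lemma typeII_coefficient {κ μ ms rhat r σ d : ℝ} (hκ : 0 < κ) (hμ : 0 < μ) (hms : 0 < ms)
    (hrhat : 0 < rhat) (hr : 0 < r) (hσ : σ = rhat / Real.sqrt (2 * μ * (1 + κ)))
    (hd : d = σ * Real.sqrt (2 * μ * κ)) (i : ℕ) :
    2 * ms ^ ms / ((i.factorial : ℝ) * Real.Gamma ms * Real.Gamma ((i : ℝ) + μ)) *
        (r ^ (2 * (i : ℝ) + 2 * μ - 1) * d ^ (2 * i) * 2 ^ (1 - μ - 2 * (i : ℝ)) *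
          σ ^ (-2 * μ - 4 * (i : ℝ))) *
        (ms / (μ * (r ^ 2 * (1 + κ) + rhat ^ 2 * κ) / rhat ^ 2)) ^
          ((2 * (i : ℝ) - ms + μ) / 2) =
      4 * (ms * μ) ^ ((2 * (i : ℝ) + ms + μ) / 2) * r ^ (2 * (i : ℝ) + 2 * μ - 1) *
          κ ^ (i : ℕ) * (1 + κ) ^ ((i : ℝ) + μ) /
          ((i.factorial : ℝ) * Real.Gamma ms * Real.Gamma ((i : ℝ) + μ) *
            (r ^ 2 * (1 + κ) + rhat ^ 2 * κ) ^ ((2 * (i : ℝ) - ms + μ) / 2) *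
            rhat ^ (ms + μ)) := by
  have hσpos : 0 < σ := by rw [hσ]; positivity
  have hdpos : 0 < d := by rw [hd]; positivity
  have hGms := Real.Gamma_pos_of_pos hms
  have hGμ : 0 < Real.Gamma ((i : ℝ) + μ) := Real.Gamma_pos_of_pos (by positivity)
  have hlogσ : Real.log σ =
      Real.log rhat - (Real.log 2 + Real.log μ + Real.log (1 + κ)) / 2 := by
    rw [hσ]
    simp (disch := positivity) only [Real.log_mul, Real.log_div, Real.log_sqrt]
  have hlogd : Real.log d = Real.log rhat + (Real.log κ - Real.log (1 + κ)) / 2 := by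
    rw [hd]
    simp (disch := positivity) only [Real.log_mul, Real.log_sqrt, hlogσ]
    ring
  have hfour : Real.log 4 = 2 * Real.log 2 := by
    rw [show (4 : ℝ) = 2 ^ 2 by norm_num, Real.log_pow]
    norm_num
  refine Real.log_injOn_pos (mem_Ioi.2 (by positivity)) (mem_Ioi.2 (by positivity)) ?_
  have hB : 0 < r ^ 2 * (1 + κ) + rhat ^ 2 * κ := by positivity
  generalize r ^ 2 * (1 + κ) + rhat ^ 2 * κ = B at hB ⊢
  simp (disch := positivity) only [Real.log_mul, Real.log_div, Real.log_rpow, Real.log_pow,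
    hlogσ, hlogd, hfour]
  push_cast
  ring

/-- Theorem 2: PDF of the single shadowed κ-μ Type II model with
Nakagami-m shadowing of the scattered components. -/
theorem single_shadowed_typeII_nakagami_pdf
    (κ μ ms rhat r σ d : ℝ)
    (hκ : 0 < κ) (hμ : 0 < μ) (hms : 0 < ms) (hrhat : 0 < rhat) (hr : 0 < r)
    (hσ : σ = rhat / Real.sqrt (2 * μ * (1 + κ)))
    (hd : d = σ * Real.sqrt (2 * μ * κ)) :
    (∫ x in Ioi (0 : ℝ),
      (r ^ μ / (σ ^ 2 * x ^ 2 * d ^ (μ - 1))) *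
        Real.exp (-(r ^ 2 + d ^ 2) / (2 * σ ^ 2 * x ^ 2)) *
        besselI (μ - 1) (d * r / (σ ^ 2 * x ^ 2)) *
        (2 * ms ^ ms * x ^ (2 * ms - 1) * Real.exp (-ms * x ^ 2) / Real.Gamma ms)) =
    ∑' i : ℕ,
      4 * (ms * μ) ^ ((2 * (i : ℝ) + ms + μ) / 2) * r ^ (2 * (i : ℝ) + 2 * μ - 1) *
          κ ^ (i : ℕ) * (1 + κ) ^ ((i : ℝ) + μ) /
          ((i.factorial : ℝ) * Real.Gamma ms * Real.Gamma ((i : ℝ) + μ) *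
            (r ^ 2 * (1 + κ) + rhat ^ 2 * κ) ^ ((2 * (i : ℝ) - ms + μ) / 2) *
            rhat ^ (ms + μ)) *
        besselK (2 * (i : ℝ) - ms + μ)
          (2 * Real.sqrt (ms * μ * (r ^ 2 * (1 + κ) + rhat ^ 2 * κ)) / rhat) := by
  have hσpos : 0 < σ := by rw [hσ]; positivity
  have hdpos : 0 < d := by rw [hd]; positivity
  have hGms := Real.Gamma_pos_of_pos hms
  have hA : 0 < μ * (r ^ 2 * (1 + κ) + rhat ^ 2 * κ) / rhat ^ 2 := by positivity
  have hterm := fun (i : ℕ) (x : ℝ) (hx : x ∈ Ioi (0 : ℝ)) =>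
    typeII_integrand_term (ms := ms) hκ hμ hrhat hr hσ hd hx i
  have hkernel := fun i : ℕ =>
    integrableOn_and_integral_rpow_mul_exp_neg_inv_sq_sub_sq hA hms (2 * (i : ℝ) - ms + μ)
  have hsqrt : 2 * Real.sqrt (μ * (r ^ 2 * (1 + κ) + rhat ^ 2 * κ) / rhat ^ 2 * ms) =
      2 * Real.sqrt (ms * μ * (r ^ 2 * (1 + κ) + rhat ^ 2 * κ)) / rhat := by
    rw [div_mul_eq_mul_div, Real.sqrt_div (by positivity), Real.sqrt_sq hrhat.le, mul_div_assoc]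
    ring_nf
  simp only [besselI, ← tsum_mul_left, ← tsum_mul_right]
  rw [setIntegral_tsum_of_nonneg measurableSet_Ioi]
  · refine tsum_congr fun i => ?_
    rw [setIntegral_congr_fun measurableSet_Ioi (hterm i), integral_const_mul, (hkernel i).2,
      hsqrt, ← mul_assoc, typeII_coefficient hκ hμ hms hrhat hr hσ hd]
  · exact fun i => IntegrableOn.congr_fun ((hkernel i).1.const_mul _)
      (fun x hx => (hterm i x hx).symm) measurableSet_Ioi
  · intro i x hx
    have hxpos : 0 < x := hx
    have hG : 0 < Real.Gamma (μ - 1 + (i : ℝ) + 1) :=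
      Real.Gamma_pos_of_pos (by have : (0 : ℝ) ≤ i := i.cast_nonneg; linarith)
    positivity
  · intro x hx
    have hxpos : 0 < x := hx
    exact ((summable_besselI (by linarith) (by positivity)).mul_left _).mul_right _
end

section
/- Let κ, μ, r̂ > 0, m_s > 1 and r > 0. Set σ = r̂/√(2μ(1+κ)) and d = σ√(2μκ). Then ∫₀^∞ (r^μ/(σ²x²d^{μ−1})) e^{−(r²+d²)/(2σ²x²)} I_{μ−1}(dr/(σ²x²)) · (2(m_s−1)^{m_s} x^{−2m_s−1} e^{−(m_s−1)/x²}/Γ(m_s)) dx = (2(m_s−1)^{m_s}(1+κ)^μ μ^μ r^{2μ−1} r̂^{2m_s} / (B(m_s,μ) [r²(1+κ)μ + r̂²(m_s−1+κμ)]^{m_s+μ})) · ₂F₁((m_s+μ)/2, (1+m_s+μ)/2; μ; 4μ²κ(1+κ)r²r̂² / [r²(1+κ)μ + r̂²(m_s−1+κμ)]²), where the argument of ₂F₁ lies in (0,1). -/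
open MeasureTheory Set

open Filter Topology

lemma poch_zero {a : ℝ} (ha : 0 < a) : poch a 0 = 1 := by
  simp [poch, (Real.Gamma_pos_of_pos ha).ne']

lemma poch_succ {a : ℝ} (ha : 0 < a) (n : ℕ) : poch a (n + 1) = (a + n) * poch a n := by
  have : a + n ≠ 0 := by positivity
  rw [poch, poch, Nat.cast_succ, ← add_assoc, Real.Gamma_add_one this, mul_div_assoc]

lemma poch_pos {a : ℝ} (ha : 0 < a) (n : ℕ) : 0 < poch a n :=
  div_pos (Real.Gamma_pos_of_pos (by positivity)) (Real.Gamma_pos_of_pos ha)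

lemma Gamma_add_natCast_eq_mul_poch {a : ℝ} (ha : 0 < a) (n : ℕ) :
    Real.Gamma (a + n) = Real.Gamma a * poch a n := by
  rw [poch, mul_div_cancel₀ _ (Real.Gamma_pos_of_pos ha).ne']

lemma poch_two_mul {a : ℝ} (ha : 0 < a) (n : ℕ) :
    poch a (2 * n) = 4 ^ n * poch (a / 2) n * poch ((1 + a) / 2) n := by
  induction n with
  | zero => simp [poch_zero, ha, show 0 < a / 2 by positivity, show 0 < (1 + a) / 2 by positivity]
  | succ n ih =>
    rw [show 2 * (n + 1) = 2 * n + 1 + 1 by ring, poch_succ ha, poch_succ ha, ih,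
      poch_succ (by positivity), poch_succ (by positivity)]
    push_cast
    ring

/-- The Gauss hypergeometric series converges for positive parameters and `0 < z < 1`. -/
lemma summable_hyp2F1 {a b c z : ℝ} (ha : 0 < a) (hb : 0 < b) (hc : 0 < c)
    (hz₀ : 0 < z) (hz₁ : z < 1) :
    Summable fun n : ℕ ↦ poch a n * poch b n * z ^ n / (poch c n * (n.factorial : ℝ)) := by
  have hpos (n : ℕ) : 0 < poch a n * poch b n * z ^ n / (poch c n * (n.factorial : ℝ)) := by
    have := poch_pos ha n
    have := poch_pos hb n
    have := poch_pos hc n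
    positivity
  refine summable_of_ratio_test_tendsto_lt_one hz₁ (.of_forall fun n ↦ (hpos n).ne') ?_
  have hlim (u v : ℝ) :
      Tendsto (fun n : ℕ ↦ (u + (n : ℝ)) / (v + n)) atTop (𝓝 1) := by
    simpa using tendsto_add_mul_div_add_mul_atTop_nhds u v 1 (one_ne_zero (α := ℝ))
  have h := ((hlim a c).mul (hlim b 1)).mul_const z
  rw [one_mul, one_mul] at h
  refine h.congr fun n ↦ ?_
  rw [Real.norm_of_nonneg (hpos _).le, Real.norm_of_nonneg (hpos _).le, poch_succ ha,
    poch_succ hb, poch_succ hc, Nat.factorial_succ]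
  have := (poch_pos ha n).ne'
  have := (poch_pos hb n).ne'
  have := (poch_pos hc n).ne'
  have : c + n ≠ 0 := by positivity
  push_cast
  field_simp
  ring

lemma integral_rpow_mul_exp_neg_div_sq {a A : ℝ} (ha : 0 < a) (hA : 0 < A) :
    ∫ x in Ioi (0 : ℝ), x ^ (-2 * a - 1) * Real.exp (-A / x ^ 2) =
      Real.Gamma a / (2 * A ^ a) := by
  have h := integral_comp_rpow_Ioi (fun t : ℝ ↦ t ^ (a - 1) * Real.exp (-(A * t)))
    (p := -2) (by norm_num)
  rw [Real.integral_rpow_mul_exp_neg_mul_Ioi ha hA] at h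
  have h' : ∫ x in Ioi (0 : ℝ), 2 * (x ^ (-2 * a - 1) * Real.exp (-A / x ^ 2)) =
      (1 / A) ^ a * Real.Gamma a := by
    rw [← h]
    refine setIntegral_congr_fun measurableSet_Ioi fun x (hx : 0 < x) ↦ ?_
    have h2 : x ^ (-2 : ℝ) = (x ^ 2)⁻¹ := by rw [Real.rpow_neg hx.le, Real.rpow_two]
    have he : x ^ (-2 * a - 1) = x ^ (-2 - 1 : ℝ) * (x ^ (-2 : ℝ)) ^ (a - 1) := by
      rw [← Real.rpow_mul hx.le, ← Real.rpow_add hx]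
      ring_nf
    simp only [smul_eq_mul]
    rw [he, h2, abs_neg, abs_two, neg_div, div_eq_mul_inv A]
    ring
  rw [integral_const_mul, Real.div_rpow zero_le_one hA.le, Real.one_rpow] at h'
  have : A ^ a ≠ 0 := by positivity
  field_simp at h' ⊢
  linarith

/-- The Mellin-type integral of a Bessel function against an inverse gamma weight. -/
lemma integral_rpow_mul_exp_neg_div_sq_mul_besselI {p ν y A : ℝ} (hν : 0 < ν + 1)
    (hs : 0 < p + ν) (hy : 0 < y) (hyA : y < A) :
    ∫ x in Ioi (0 : ℝ), x ^ (-2 * p - 1) * Real.exp (-A / x ^ 2) * besselI ν (y / x ^ 2) =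
      (y / 2) ^ ν * Real.Gamma (p + ν) / (2 * A ^ (p + ν) * Real.Gamma (ν + 1)) *
        hyp2F1 ((p + ν) / 2) ((1 + (p + ν)) / 2) (ν + 1) (y ^ 2 / A ^ 2) := by
  have hA : 0 < A := hy.trans hyA
  set s := p + ν with hs_def
  let F (k : ℕ) (x : ℝ) : ℝ := x ^ (-2 * p - 1) * Real.exp (-A / x ^ 2) *
    ((y / x ^ 2 / 2) ^ (ν + 2 * (k : ℝ)) / ((k.factorial : ℝ) * Real.Gamma (ν + (k : ℝ) + 1)))
  have hΓ (k : ℕ) : 0 < Real.Gamma (ν + k + 1) := by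
    rw [add_right_comm]
    exact Real.Gamma_pos_of_pos (by positivity)
  have hF (k : ℕ) {x : ℝ} (hx : 0 < x) : F k x =
      (y / 2) ^ (ν + 2 * (k : ℝ)) / ((k.factorial : ℝ) * Real.Gamma (ν + (k : ℝ) + 1)) *
        (x ^ (-2 * (s + 2 * k) - 1) * Real.exp (-A / x ^ 2)) := by
    have h1 : (y / x ^ 2 / 2) ^ (ν + 2 * (k : ℝ)) =
        (y / 2) ^ (ν + 2 * (k : ℝ)) * x ^ (-2 * (ν + 2 * (k : ℝ))) := by
      rw [Real.rpow_mul hx.le, ← Real.mul_rpow (by positivity) (by positivity),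
        Real.rpow_neg hx.le, Real.rpow_two]
      congr 1
      ring
    have h2 : x ^ (-2 * (s + 2 * k) - 1) = x ^ (-2 * p - 1) * x ^ (-2 * (ν + 2 * (k : ℝ))) := by
      rw [← Real.rpow_add hx, hs_def]
      ring_nf
    simp only [F]
    rw [h1, h2]
    ring
  have hint (k : ℕ) : ∫ x in Ioi (0 : ℝ), F k x =
      (y / 2) ^ ν * Real.Gamma s / (2 * A ^ s * Real.Gamma (ν + 1)) *
        (poch (s / 2) k * poch ((1 + s) / 2) k * (y ^ 2 / A ^ 2) ^ k /
          (poch (ν + 1) k * (k.factorial : ℝ))) := by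
    rw [setIntegral_congr_fun measurableSet_Ioi fun x hx ↦ hF k hx, integral_const_mul,
      integral_rpow_mul_exp_neg_div_sq (by positivity) hA]
    have h1 : Real.Gamma (s + 2 * k) =
        Real.Gamma s * (4 ^ k * poch (s / 2) k * poch ((1 + s) / 2) k) := by
      rw [← poch_two_mul hs, ← Gamma_add_natCast_eq_mul_poch hs]
      push_cast
      rfl
    have h2 : ∀ {u : ℝ}, 0 < u → ∀ t : ℝ, u ^ (t + 2 * (k : ℝ)) = u ^ t * (u ^ 2) ^ k := by
      intro u hu t
      rw [Real.rpow_add hu, Real.rpow_mul hu.le, Real.rpow_two, Real.rpow_natCast]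
    rw [h1, h2 (by positivity), h2 hA, add_right_comm, Gamma_add_natCast_eq_mul_poch hν,
      show (y / 2) ^ 2 = y ^ 2 / 4 by ring, div_pow, div_pow]
    have := (poch_pos hν k).ne'
    have := (Real.Gamma_pos_of_pos hν).ne'
    field_simp
  have hne (k : ℕ) : ∫ x in Ioi (0 : ℝ), F k x ≠ 0 := by
    rw [hint]
    have := poch_pos (show 0 < s / 2 by positivity) k
    have := poch_pos (show 0 < (1 + s) / 2 by positivity) k
    have := poch_pos hν k
    have := Real.Gamma_pos_of_pos hν
    have := Real.Gamma_pos_of_pos hs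
    positivity
  have hnorm (k : ℕ) : ∫ x in Ioi (0 : ℝ), ‖F k x‖ = ∫ x in Ioi (0 : ℝ), F k x := by
    refine setIntegral_congr_fun measurableSet_Ioi fun x (hx : 0 < x) ↦ ?_
    have := hΓ k
    exact Real.norm_of_nonneg (by positivity)
  have hz : y ^ 2 / A ^ 2 < 1 := by
    rw [div_lt_one (by positivity)]
    gcongr
  have hsum := summable_hyp2F1 (show 0 < s / 2 by positivity)
    (show 0 < (1 + s) / 2 by positivity) hν (show 0 < y ^ 2 / A ^ 2 by positivity) hz
  simp only [besselI, hyp2F1, ← tsum_mul_left, ← hint]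
  refine (integral_tsum_of_summable_integral_norm (F := F)
    (fun k ↦ .of_integral_ne_zero (hne k)) ?_).symm
  simp only [hnorm, hint]
  exact hsum.mul_left _

/-- Theorem 3: PDF of the single shadowed κ-μ Type II model with
inverse Nakagami-m shadowing of the scattered components. -/
theorem single_shadowed_typeII_inverse_nakagami_pdf
    (κ μ ms rhat r σ d : ℝ)
    (hκ : 0 < κ) (hμ : 0 < μ) (hrhat : 0 < rhat) (hms : 1 < ms) (hr : 0 < r)
    (hσ : σ = rhat / Real.sqrt (2 * μ * (1 + κ)))
    (hd : d = σ * Real.sqrt (2 * μ * κ)) :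
    (0 < 4 * μ ^ 2 * κ * (1 + κ) * r ^ 2 * rhat ^ 2 /
        (r ^ 2 * (1 + κ) * μ + rhat ^ 2 * (ms - 1 + κ * μ)) ^ 2 ∧
      4 * μ ^ 2 * κ * (1 + κ) * r ^ 2 * rhat ^ 2 /
        (r ^ 2 * (1 + κ) * μ + rhat ^ 2 * (ms - 1 + κ * μ)) ^ 2 < 1) ∧
    (∫ x in Ioi (0 : ℝ),
      (r ^ μ / (σ ^ 2 * x ^ 2 * d ^ (μ - 1))) *
        Real.exp (-(r ^ 2 + d ^ 2) / (2 * σ ^ 2 * x ^ 2)) *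
        besselI (μ - 1) (d * r / (σ ^ 2 * x ^ 2)) *
        (2 * (ms - 1) ^ ms * x ^ (-2 * ms - 1) *
          Real.exp (-(ms - 1) / x ^ 2) / Real.Gamma ms)) =
    (2 * (ms - 1) ^ ms * (1 + κ) ^ μ * μ ^ μ * r ^ (2 * μ - 1) * rhat ^ (2 * ms) /
        (betaFn ms μ *
          (r ^ 2 * (1 + κ) * μ + rhat ^ 2 * (ms - 1 + κ * μ)) ^ (ms + μ))) *
      hyp2F1 ((ms + μ) / 2) ((1 + ms + μ) / 2) μ
        (4 * μ ^ 2 * κ * (1 + κ) * r ^ 2 * rhat ^ 2 /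
          (r ^ 2 * (1 + κ) * μ + rhat ^ 2 * (ms - 1 + κ * μ)) ^ 2) := by
  have hms' : 0 < ms - 1 := by linarith
  set D := r ^ 2 * (1 + κ) * μ + rhat ^ 2 * (ms - 1 + κ * μ) with hD_def
  have hD : 0 < D := by positivity
  have hz₁ : 4 * μ ^ 2 * κ * (1 + κ) * r ^ 2 * rhat ^ 2 / D ^ 2 < 1 := by
    rw [div_lt_one (by positivity)]
    have h1 : 0 < rhat ^ 2 * (ms - 1) := by positivity
    have h2 : 0 < r ^ 2 * (1 + κ) * μ + rhat ^ 2 * κ * μ := by positivity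
    nlinarith [sq_nonneg (r ^ 2 * (1 + κ) * μ - rhat ^ 2 * κ * μ), mul_pos h1 h2, mul_pos h1 h1]
  refine ⟨⟨by positivity, hz₁⟩, ?_⟩
  have hσ₀ : 0 < σ := by rw [hσ]; positivity
  have hd₀ : 0 < d := by rw [hd]; positivity
  have hσ2 : σ ^ 2 = rhat ^ 2 / (2 * μ * (1 + κ)) := by
    rw [hσ, div_pow, Real.sq_sqrt (by positivity)]
  have hd2 : d ^ 2 = σ ^ 2 * (2 * μ * κ) := by
    rw [hd, mul_pow, Real.sq_sqrt (by positivity)]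
  set y := d * r / σ ^ 2 with hy_def
  set A := D / rhat ^ 2 with hA_def
  have hy : 0 < y := by positivity
  have hA : 0 < A := by positivity
  have hyA : y ^ 2 / A ^ 2 = 4 * μ ^ 2 * κ * (1 + κ) * r ^ 2 * rhat ^ 2 / D ^ 2 := by
    rw [hy_def, hA_def, div_pow, mul_pow, hd2, hσ2]
    field_simp
    ring
  have hlt : y < A := by
    rw [← hyA, div_lt_one (by positivity)] at hz₁
    exact lt_of_pow_lt_pow_left₀ 2 hA.le hz₁
  have hexp : (r ^ 2 + d ^ 2) / (2 * σ ^ 2) + (ms - 1) = A := by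
    rw [hA_def, hD_def, hd2, hσ2]
    field_simp
    ring
  have key := integral_rpow_mul_exp_neg_div_sq_mul_besselI (p := ms + 1) (ν := μ - 1)
    (by linarith) (by linarith) hy hlt
  rw [show ms + 1 + (μ - 1) = ms + μ by ring, sub_add_cancel, hyA, ← add_assoc] at key
  have hcongr : ∀ x ∈ Ioi (0 : ℝ),
      (r ^ μ / (σ ^ 2 * x ^ 2 * d ^ (μ - 1))) *
        Real.exp (-(r ^ 2 + d ^ 2) / (2 * σ ^ 2 * x ^ 2)) *
        besselI (μ - 1) (d * r / (σ ^ 2 * x ^ 2)) *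
        (2 * (ms - 1) ^ ms * x ^ (-2 * ms - 1) *
          Real.exp (-(ms - 1) / x ^ 2) / Real.Gamma ms) =
      (r ^ μ / (σ ^ 2 * d ^ (μ - 1)) * (2 * (ms - 1) ^ ms / Real.Gamma ms)) *
        (x ^ (-2 * (ms + 1) - 1) * Real.exp (-A / x ^ 2) * besselI (μ - 1) (y / x ^ 2)) := by
    intro x (hx : 0 < x)
    have h1 : Real.exp (-A / x ^ 2) = Real.exp (-(r ^ 2 + d ^ 2) / (2 * σ ^ 2 * x ^ 2)) *
        Real.exp (-(ms - 1) / x ^ 2) := by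
      rw [← Real.exp_add, ← hexp]
      congr 1
      field_simp
      ring
    have h2 : x ^ (-2 * (ms + 1) - 1) = x ^ (-2 * ms - 1) / x ^ 2 := by
      rw [← Real.rpow_two, ← Real.rpow_sub hx]
      ring_nf
    rw [h1, h2, hy_def, div_div]
    field_simp
  rw [setIntegral_congr_fun measurableSet_Ioi hcongr, integral_const_mul, key, ← mul_assoc]
  congr 1
  have hΓ := (Real.Gamma_pos_of_pos (show 0 < ms by linarith)).ne'
  have hΓμ := (Real.Gamma_pos_of_pos hμ).ne'
  have hy2 : (y / 2) ^ (μ - 1) =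
      d ^ (μ - 1) * (r ^ μ / r) * ((1 + κ) ^ μ * μ ^ μ / (rhat ^ μ) ^ 2) /
        ((1 + κ) * μ / rhat ^ 2) := by
    rw [show y / 2 = d * r * ((1 + κ) * μ / rhat ^ 2) by
        rw [hy_def, hσ2]
        field_simp,
      Real.mul_rpow (by positivity) (by positivity), Real.mul_rpow hd₀.le hr.le,
      Real.rpow_sub_one (show (1 + κ) * μ / rhat ^ 2 ≠ 0 by positivity),
      Real.rpow_sub_one hr.ne', Real.div_rpow (by positivity) (by positivity),
      Real.mul_rpow (by positivity) hμ.le, Real.rpow_pow_comm hrhat.le]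
    ring
  have hr2 : r ^ (2 * μ - 1) = (r ^ μ) ^ 2 / r := by
    rw [Real.rpow_sub_one hr.ne', mul_comm, Real.rpow_mul hr.le, Real.rpow_two]
  have hA2 : A ^ (ms + μ) = D ^ (ms + μ) / (rhat ^ (2 * ms) * (rhat ^ μ) ^ 2) := by
    rw [hA_def, Real.div_rpow hD.le (by positivity),
      Real.rpow_add (show 0 < rhat ^ 2 by positivity),
      Real.rpow_mul hrhat.le, Real.rpow_two, Real.rpow_pow_comm hrhat.le μ]
  have hΓs := (Real.Gamma_pos_of_pos (show 0 < ms + μ by linarith)).ne'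
  rw [hy2, hr2, hA2, betaFn, hσ2]
  field_simp
end

section
/- Let κ, μ, m_t, r̂ > 0 and r > 0. Then the mixture of the scaled κ-μ density against the unit-power Nakagami-m density satisfies ∫₀^∞ (2μ(1+κ)^{(μ+1)/2} r^μ e^{−μ(1+κ)r²/(x²r̂²)} / (κ^{(μ−1)/2} e^{κμ} (x²r̂²)^{(μ+1)/2})) · I_{μ−1}(2μ√(κ(1+κ)) r/(x r̂)) · (2 m_t^{m_t} x^{2m_t−1} e^{−m_t x²}/Γ(m_t)) dx = ∑_{i=0}^∞ (4(m_t μ(1+κ))^{(m_t+μ+i)/2} (κμ)^i r^{m_t+μ+i−1} / (e^{κμ} i! Γ(m_t) Γ(i+μ) r̂^{m_t+μ+i})) · K_{μ+i−m_t}(2r√(m_t μ(1+κ))/r̂). -/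
open MeasureTheory Set

open Filter Topology

theorem besselK_neg (ν x : ℝ) : besselK (-ν) x = besselK ν x := by
  simp [besselK]

/-- The power series of `besselI` converges for positive arguments and orders above `-1`. -/
theorem summable_besselI_series {ν x : ℝ} (hν : -1 < ν) (hx : 0 < x) :
    Summable fun k : ℕ ↦
      (x / 2) ^ (ν + 2 * (k : ℝ)) / ((k.factorial : ℝ) * Real.Gamma (ν + (k : ℝ) + 1)) := by
  have hx2 : 0 < x / 2 := by positivity
  have hpos (k : ℕ) : 0 < ν + (k : ℝ) + 1 := by
    have : (0 : ℝ) ≤ k := k.cast_nonneg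
    linarith
  have hΓ (k : ℕ) := Real.Gamma_pos_of_pos (hpos k)
  have hterm (k : ℕ) : 0 < (x / 2) ^ (ν + 2 * (k : ℝ)) /
      ((k.factorial : ℝ) * Real.Gamma (ν + (k : ℝ) + 1)) := by
    have := hΓ k
    positivity
  refine summable_of_ratio_test_tendsto_lt_one (l := 0) one_pos
    (Eventually.of_forall fun k ↦ (hterm k).ne') ?_
  have hratio (k : ℕ) :
      ‖(x / 2) ^ (ν + 2 * ((k + 1 : ℕ) : ℝ)) /
          (((k + 1).factorial : ℝ) * Real.Gamma (ν + ((k + 1 : ℕ) : ℝ) + 1))‖ /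
        ‖(x / 2) ^ (ν + 2 * (k : ℝ)) / ((k.factorial : ℝ) * Real.Gamma (ν + (k : ℝ) + 1))‖ =
      (x / 2) ^ 2 * (1 / ((k : ℝ) + 1)) * (ν + (k : ℝ) + 1)⁻¹ := by
    rw [Real.norm_of_nonneg (hterm _).le, Real.norm_of_nonneg (hterm _).le]
    have h1 : (x / 2) ^ (ν + 2 * ((k + 1 : ℕ) : ℝ)) = (x / 2) ^ (ν + 2 * (k : ℝ)) * (x / 2) ^ 2 := by
      rw [← Real.rpow_natCast, ← Real.rpow_add hx2]
      push_cast
      ring_nf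
    have h2 : Real.Gamma (ν + ((k + 1 : ℕ) : ℝ) + 1) =
        (ν + (k : ℝ) + 1) * Real.Gamma (ν + (k : ℝ) + 1) := by
      rw [← Real.Gamma_add_one (hpos k).ne']
      push_cast
      ring_nf
    rw [h1, h2, Nat.factorial_succ]
    have := (hΓ k).ne'
    have := (hpos k).ne'
    have := (Real.rpow_pos_of_pos hx2 (ν + 2 * (k : ℝ))).ne'
    push_cast
    field_simp
  simp_rw [hratio]
  have hinv : Tendsto (fun k : ℕ ↦ (ν + (k : ℝ) + 1)⁻¹) atTop (𝓝 0) := by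
    refine tendsto_inv_atTop_zero.comp ?_
    exact tendsto_atTop_add_const_right _ _
      (tendsto_atTop_add_const_left _ _ tendsto_natCast_atTop_atTop)
  simpa using ((tendsto_one_div_add_atTop_nhds_zero_nat (𝕜 := ℝ)).const_mul ((x / 2) ^ 2)).mul hinv

theorem integrableOn_rpow_mul_exp_neg_sq_sub_inv_sq {a b : ℝ} (ha : 0 < a) (hb : 0 < b) (s : ℝ) :
    IntegrableOn (fun x : ℝ ↦ x ^ (2 * s - 1) * Real.exp (-a * x ^ 2 - b / x ^ 2)) (Ioi 0) := by
  obtain ⟨n, hn⟩ := exists_nat_gt (-s)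
  have hdom := (integrableOn_rpow_mul_exp_neg_mul_sq ha
    (s := 2 * s - 1 + 2 * n) (by linarith)).const_mul (n.factorial / b ^ n : ℝ)
  refine hdom.mono' (by fun_prop) ?_
  refine (ae_restrict_iff' measurableSet_Ioi).2 (Eventually.of_forall fun x hx ↦ ?_)
  have hx : 0 < x := hx
  rw [Real.norm_of_nonneg (by positivity)]
  have hexp : Real.exp (-(b / x ^ 2)) ≤ n.factorial / b ^ n * x ^ (2 * n) := by
    have h := Real.pow_div_factorial_le_exp (b / x ^ 2) (by positivity) n
    have h' := inv_anti₀ (by positivity) h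
    rw [Real.exp_neg]
    refine h'.trans_eq ?_
    rw [div_pow, ← pow_mul]
    field_simp
  have hpow : x ^ (2 * s - 1 + 2 * n) = x ^ (2 * s - 1) * x ^ (2 * n) := by
    rw [Real.rpow_add hx, ← Real.rpow_natCast x (2 * n)]
    push_cast
    rfl
  calc x ^ (2 * s - 1) * Real.exp (-a * x ^ 2 - b / x ^ 2)
      = x ^ (2 * s - 1) * Real.exp (-a * x ^ 2) * Real.exp (-(b / x ^ 2)) := by
        rw [mul_assoc, ← Real.exp_add]
        ring_nf
    _ ≤ x ^ (2 * s - 1) * Real.exp (-a * x ^ 2) * (n.factorial / b ^ n * x ^ (2 * n)) := by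
        gcongr
    _ = _ := by rw [hpow]; ring

theorem integral_rpow_mul_exp_neg_sq_sub_inv_sq {a b : ℝ} (ha : 0 < a) (hb : 0 < b) (s : ℝ) :
    ∫ x in Ioi (0 : ℝ), x ^ (2 * s - 1) * Real.exp (-a * x ^ 2 - b / x ^ 2) =
      (b / a) ^ (s / 2) * besselK s (2 * √(a * b)) := by
  set c : ℝ := (b / a) ^ (1 / 4 : ℝ) with hc
  have hba : 0 < b / a := div_pos hb ha
  have hc0 : 0 < c := Real.rpow_pos_of_pos hba _
  have hc4 : c ^ 4 = b / a := by
    rw [hc, ← Real.rpow_natCast, ← Real.rpow_mul hba.le]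
    norm_num
  have hcs : c ^ (2 * s) = (b / a) ^ (s / 2) := by
    rw [hc, ← Real.rpow_mul hba.le]
    ring_nf
  have hb' : b = a * c ^ 4 := by rw [hc4]; field_simp
  have hz : √(a * b) = a * c ^ 2 := by
    rw [show a * b = (a * c ^ 2) ^ 2 by rw [hb']; ring, Real.sqrt_sq (by positivity)]
  set z : ℝ := 2 * √(a * b) with hz'
  set f : ℝ → ℝ := fun t ↦ c * Real.exp (t / 2)
  set g : ℝ → ℝ := fun x ↦ x ^ (2 * s - 1) * Real.exp (-a * x ^ 2 - b / x ^ 2)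
  have hf' (t : ℝ) : HasDerivAt f (f t / 2) t := by
    refine ((((hasDerivAt_id t).div_const 2).exp).const_mul c).congr_deriv ?_
    simp only [f, id]
    ring
  have hfinj : InjOn f univ := by
    intro t _ u _ h
    have h : Real.exp (t / 2) = Real.exp (u / 2) := mul_left_cancel₀ hc0.ne' h
    have := Real.exp_injective h
    linarith
  have himage : f '' univ = Ioi 0 := by
    ext y
    constructor
    · rintro ⟨t, -, rfl⟩
      exact mul_pos hc0 (Real.exp_pos _)
    · intro hy
      have hy : 0 < y := hy
      refine ⟨2 * Real.log (y / c), trivial, ?_⟩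
      simp only [f]
      rw [mul_div_cancel_left₀ _ two_ne_zero, Real.exp_log (by positivity)]
      field_simp
  set h : ℝ → ℝ := fun t ↦ (b / a) ^ (s / 2) / 2 * (Real.exp (s * t) * Real.exp (-z * Real.cosh t))
  have hpull (t : ℝ) : |f t / 2| • g (f t) = h t := by
    have hft : 0 < f t := mul_pos hc0 (Real.exp_pos _)
    rw [abs_of_pos (by positivity), smul_eq_mul]
    have hp : f t * f t ^ (2 * s - 1) = (b / a) ^ (s / 2) * Real.exp (s * t) := by
      rw [mul_comm, ← Real.rpow_add_one hft.ne', show 2 * s - 1 + 1 = 2 * s by ring,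
        Real.mul_rpow hc0.le (Real.exp_pos _).le, hcs, ← Real.exp_mul]
      ring_nf
    have he : -a * f t ^ 2 - b / f t ^ 2 = -z * Real.cosh t := by
      have hsq : f t ^ 2 = c ^ 2 * Real.exp t := by
        simp only [f]
        rw [mul_pow, ← Real.exp_nat_mul]
        ring_nf
      rw [hsq, hz', hz, Real.cosh_eq, Real.exp_neg]
      rw [show b / (c ^ 2 * Real.exp t) = a * c ^ 2 / Real.exp t by rw [hb']; field_simp]
      have := Real.exp_pos t
      field_simp
      ring
    simp only [g, h]
    rw [he]
    linear_combination (Real.exp (-z * Real.cosh t) / 2) * hp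
  have hint : Integrable h := by
    have := (integrableOn_image_iff_integrableOn_abs_deriv_smul MeasurableSet.univ
      (fun t _ ↦ (hf' t).hasDerivWithinAt) hfinj g).1
      (himage ▸ integrableOn_rpow_mul_exp_neg_sq_sub_inv_sq ha hb s)
    simpa only [hpull, integrableOn_univ] using this
  have hsubst := integral_image_eq_integral_abs_deriv_smul MeasurableSet.univ
      (fun t _ ↦ (hf' t).hasDerivWithinAt) hfinj g
  rw [himage] at hsubst
  rw [hsubst]
  simp only [hpull, Measure.restrict_univ]
  rw [← intervalIntegral.integral_Iic_add_Ioi (b := 0) hint.integrableOn hint.integrableOn]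
  have hneg := integral_comp_neg_Ioi 0 h
  rw [neg_zero] at hneg
  rw [← hneg, ← integral_add hint.comp_neg.integrableOn hint.integrableOn, besselK,
    ← integral_const_mul]
  refine integral_congr_ae (Eventually.of_forall fun t ↦ ?_)
  simp only [h, Real.cosh_neg, Real.cosh_eq (s * t)]
  ring_nf

theorem power_factor_integrand {μ κ p r h x m : ℝ} (hμ : 0 < μ) (hκ : 0 < κ) (hp : 0 < p)
    (hr : 0 < r) (hh : 0 < h) (hx : 0 < x) (u : ℝ) (i : ℕ) :
    μ * p ^ ((u + 1) / 2) * r ^ u / (κ ^ ((u - 1) / 2) * (x ^ 2 * h ^ 2) ^ ((u + 1) / 2)) *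
        (2 * μ * √(κ * p) * r / (x * h) / 2) ^ (u - 1 + 2 * (i : ℝ)) * x ^ (2 * m - 1) =
      μ ^ (u + 2 * (i : ℝ)) * p ^ (u + i) * κ ^ i * r ^ (2 * u - 1 + 2 * i) *
        h ^ (-(2 * u + 2 * i)) * x ^ (2 * (m - u - i) - 1) := by
  rw [show 2 * μ * √(κ * p) * r / (x * h) / 2 = μ * √(κ * p) * r / (x * h) by ring]
  rw [← Real.exp_log hμ, ← Real.exp_log hκ, ← Real.exp_log hp, ← Real.exp_log hr,
    ← Real.exp_log hh, ← Real.exp_log hx]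
  simp only [← Real.exp_mul, ← Real.exp_nat_mul, ← Real.exp_add, Real.sqrt_eq_rpow,
    ← Real.exp_sub]
  congr 1
  push_cast
  ring

theorem power_factor_integral {μ κ p r h m : ℝ} (hμ : 0 < μ) (hκ : 0 < κ) (hp : 0 < p)
    (hr : 0 < r) (hh : 0 < h) (hm : 0 < m) (u v : ℝ) (i : ℕ) :
    μ ^ (u + 2 * (i : ℝ)) * p ^ (u + i) * κ ^ i * r ^ (2 * u - 1 + 2 * i) *
        h ^ (-(2 * u + 2 * i)) * m ^ v * (μ * p * r ^ 2 / h ^ 2 / m) ^ ((v - u - i) / 2) =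
      (m * μ * p) ^ ((v + u + (i : ℝ)) / 2) * (κ * μ) ^ i * r ^ (v + u + (i : ℝ) - 1) /
        h ^ (v + u + (i : ℝ)) := by
  rw [← Real.exp_log hμ, ← Real.exp_log hκ, ← Real.exp_log hp, ← Real.exp_log hr,
    ← Real.exp_log hh, ← Real.exp_log hm]
  simp only [← Real.exp_mul, ← Real.exp_nat_mul, ← Real.exp_add, ← Real.exp_sub]
  congr 1
  push_cast
  ring

theorem integral_tsum_of_nonneg {α : Type*} [MeasurableSpace α] {ν : Measure α}
    {F : ℕ → α → ℝ} (hF : ∀ i, Integrable (F i) ν) (h0 : ∀ i, ∀ᵐ x ∂ν, 0 ≤ F i x)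
    (hs : ∀ᵐ x ∂ν, Summable fun i ↦ F i x) :
    ∫ x, ∑' i, F i x ∂ν = ∑' i, ∫ x, F i x ∂ν := by
  have h0' := ae_all_iff.2 h0
  have hmeas : AEStronglyMeasurable (fun x ↦ ∑' i, F i x) ν :=
    aestronglyMeasurable_of_tendsto_ae atTop
      (fun n ↦ Finset.aestronglyMeasurable_fun_sum (Finset.range n)
        fun i _ ↦ (hF i).aestronglyMeasurable)
      (hs.mono fun x hx ↦ hx.hasSum.tendsto_sum_nat)
  rw [integral_eq_lintegral_of_nonneg_ae (h0'.mono fun x hx ↦ tsum_nonneg hx) hmeas]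
  have hcongr : ∫⁻ x, ENNReal.ofReal (∑' i, F i x) ∂ν =
      ∑' i, ∫⁻ x, ENNReal.ofReal (F i x) ∂ν := by
    rw [← lintegral_tsum fun i ↦ (hF i).aestronglyMeasurable.aemeasurable.ennreal_ofReal]
    refine lintegral_congr_ae ?_
    filter_upwards [h0', hs] with x hx hsx
    exact ENNReal.ofReal_tsum_of_nonneg hx hsx
  rw [hcongr, ENNReal.tsum_toReal_eq fun i ↦ (hF i).lintegral_lt_top.ne]
  exact tsum_congr fun i ↦
    (integral_eq_lintegral_of_nonneg_ae (h0 i) (hF i).aestronglyMeasurable).symm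

/-- Theorem 4: PDF of the single shadowed κ-μ Type III model with
Nakagami-m multiplicative shadowing. -/
theorem single_shadowed_typeIII_nakagami_pdf
    (κ μ mt rhat r : ℝ)
    (hκ : 0 < κ) (hμ : 0 < μ) (hmt : 0 < mt) (hrhat : 0 < rhat) (hr : 0 < r) :
    (∫ x in Ioi (0 : ℝ),
      (2 * μ * (1 + κ) ^ ((μ + 1) / 2) * r ^ μ *
          Real.exp (-μ * (1 + κ) * r ^ 2 / (x ^ 2 * rhat ^ 2)) /
          (κ ^ ((μ - 1) / 2) * Real.exp (κ * μ) * (x ^ 2 * rhat ^ 2) ^ ((μ + 1) / 2))) *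
        besselI (μ - 1) (2 * μ * Real.sqrt (κ * (1 + κ)) * r / (x * rhat)) *
        (2 * mt ^ mt * x ^ (2 * mt - 1) * Real.exp (-mt * x ^ 2) / Real.Gamma mt)) =
    ∑' i : ℕ,
      4 * (mt * μ * (1 + κ)) ^ ((mt + μ + (i : ℝ)) / 2) * (κ * μ) ^ (i : ℕ) *
          r ^ (mt + μ + (i : ℝ) - 1) /
          (Real.exp (κ * μ) * (i.factorial : ℝ) * Real.Gamma mt *
            Real.Gamma ((i : ℝ) + μ) * rhat ^ (mt + μ + (i : ℝ))) *
        besselK (μ + (i : ℝ) - mt) (2 * r * Real.sqrt (mt * μ * (1 + κ)) / rhat) := by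
  have hp : 0 < 1 + κ := by positivity
  have hΓm := Real.Gamma_pos_of_pos hmt
  have hΓ (i : ℕ) : 0 < Real.Gamma ((i : ℝ) + μ) := Real.Gamma_pos_of_pos (by positivity)
  set b : ℝ := μ * (1 + κ) * r ^ 2 / rhat ^ 2 with hb
  have hb0 : 0 < b := by positivity
  set C : ℕ → ℝ := fun i ↦ 4 * (μ ^ (μ + 2 * (i : ℝ)) * (1 + κ) ^ (μ + i) * κ ^ i *
    r ^ (2 * μ - 1 + 2 * i) * rhat ^ (-(2 * μ + 2 * i)) * mt ^ mt) /
    (Real.exp (κ * μ) * (i.factorial : ℝ) * Real.Gamma mt * Real.Gamma ((i : ℝ) + μ)) with hC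
  have hC0 (i : ℕ) : 0 < C i := by
    have := hΓ i
    positivity
  set F : ℕ → ℝ → ℝ := fun i x ↦
    C i * (x ^ (2 * (mt - μ - i) - 1) * Real.exp (-mt * x ^ 2 - b / x ^ 2)) with hF
  have hexpand (x : ℝ) (hx : 0 < x) :
      HasSum (fun i ↦ F i x)
        ((2 * μ * (1 + κ) ^ ((μ + 1) / 2) * r ^ μ *
          Real.exp (-μ * (1 + κ) * r ^ 2 / (x ^ 2 * rhat ^ 2)) /
          (κ ^ ((μ - 1) / 2) * Real.exp (κ * μ) * (x ^ 2 * rhat ^ 2) ^ ((μ + 1) / 2))) *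
        besselI (μ - 1) (2 * μ * Real.sqrt (κ * (1 + κ)) * r / (x * rhat)) *
        (2 * mt ^ mt * x ^ (2 * mt - 1) * Real.exp (-mt * x ^ 2) / Real.Gamma mt)) := by
    have hI := ((summable_besselI_series (ν := μ - 1)
      (x := 2 * μ * Real.sqrt (κ * (1 + κ)) * r / (x * rhat)) (by linarith)
      (by positivity)).hasSum.mul_left (2 * μ * (1 + κ) ^ ((μ + 1) / 2) * r ^ μ *
          Real.exp (-μ * (1 + κ) * r ^ 2 / (x ^ 2 * rhat ^ 2)) /
          (κ ^ ((μ - 1) / 2) * Real.exp (κ * μ) * (x ^ 2 * rhat ^ 2) ^ ((μ + 1) / 2)))).mul_right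
        (2 * mt ^ mt * x ^ (2 * mt - 1) * Real.exp (-mt * x ^ 2) / Real.Gamma mt)
    refine hI.congr_fun fun i ↦ ?_
    have hpow := power_factor_integrand (m := mt) hμ hκ hp hr hrhat hx μ i
    have hexp : Real.exp (-mt * x ^ 2 - b / x ^ 2) =
        Real.exp (-μ * (1 + κ) * r ^ 2 / (x ^ 2 * rhat ^ 2)) * Real.exp (-mt * x ^ 2) := by
      rw [← Real.exp_add]
      congr 1
      rw [hb]
      field_simp
      ring
    have hg : μ - 1 + (i : ℝ) + 1 = i + μ := by ring
    simp only [hF, hC, hexp, hg]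
    linear_combination (4 * mt ^ mt * Real.exp (-μ * (1 + κ) * r ^ 2 / (x ^ 2 * rhat ^ 2)) *
      Real.exp (-mt * x ^ 2) /
      (Real.exp (κ * μ) * (i.factorial : ℝ) * Real.Gamma mt * Real.Gamma ((i : ℝ) + μ))) * (-hpow)
  have hpos : ∀ᵐ x ∂(volume.restrict (Ioi (0 : ℝ))), 0 < x :=
    ae_restrict_mem measurableSet_Ioi
  have hlhs := setIntegral_congr_fun (μ := volume) measurableSet_Ioi
    (fun x hx ↦ (hexpand x hx).tsum_eq)
  rw [← hlhs, integral_tsum_of_nonneg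
    (fun i ↦ (integrableOn_rpow_mul_exp_neg_sq_sub_inv_sq hmt hb0 _).const_mul _)
    (fun i ↦ hpos.mono fun x hx ↦ mul_nonneg (hC0 i).le (by positivity))
    (hpos.mono fun x hx ↦ (hexpand x hx).summable)]
  refine tsum_congr fun i ↦ ?_
  have hpow := power_factor_integral hμ hκ hp hr hrhat hmt μ mt i
  have hsqrt : 2 * √(mt * b) = 2 * r * √(mt * μ * (1 + κ)) / rhat := by
    rw [show mt * b = (mt * μ * (1 + κ)) * (r / rhat) ^ 2 by rw [hb]; ring,
      Real.sqrt_mul (by positivity), Real.sqrt_sq (by positivity)]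
    ring
  rw [integral_const_mul, integral_rpow_mul_exp_neg_sq_sub_inv_sq hmt hb0, hsqrt, ← besselK_neg,
    show -(mt - μ - (i : ℝ)) = μ + i - mt by ring]
  simp only [hC]
  linear_combination (4 / (Real.exp (κ * μ) * (i.factorial : ℝ) * Real.Gamma mt *
    Real.Gamma ((i : ℝ) + μ)) *
    besselK (μ + (i : ℝ) - mt) (2 * r * √(mt * μ * (1 + κ)) / rhat)) * hpow
end

section
/- Let κ, μ, m_d, r̂ > 0, m_s > 1 and r > 0. Set σ = r̂/√(2μ(1+κ)), d = σ√(2μκ), θ₁ = (1+m_s+μ)/2 and θ₂ = m_d((m_s−1)r̂² + r²(1+κ)μ)/(r̂²κμ). Then the double mixture ∫₀^∞∫₀^∞ (r^μ/(σ²α²(βd)^{μ−1})) e^{−(r²+β²d²)/(2σ²α²)} I_{μ−1}(βdr/(σ²α²)) · (2(m_s−1)^{m_s} α^{−2m_s−1} e^{−(m_s−1)/α²}/Γ(m_s)) · (2 m_d^{m_d} β^{2m_d−1} e^{−m_d β²}/Γ(m_d)) dα dβ = (2(m_s−1)^{m_s} m_d^{m_s+μ} r^{2μ−1} Γ(μ+m_s)(1+κ)^μ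 / (κ^{m_s+μ} Γ(m_s) Γ(m_d) μ^{m_s} r̂^{2μ})) · ∑_{i=0}^∞ (2^{2i} ((μ+m_s)/2)_i (θ₁)_i Γ(i+m_d) / (i! Γ(μ+i))) (m_d(1+κ)r²/(r̂²κ))^i · U(2i+μ+m_s, 1+i+μ−m_d+m_s, θ₂). -/
open MeasureTheory Set

lemma integrableOn_rpow_mul_exp_neg_mul {a c : ℝ} (ha : 0 < a) (hc : 0 < c) :
    IntegrableOn (fun t : ℝ => t ^ (a - 1) * Real.exp (-(c * t))) (Ioi 0) := by
  have h := integrableOn_rpow_mul_exp_neg_mul_rpow (p := 1) (s := a - 1) (b := c)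
    (by linarith) one_pos hc
  simpa [Real.rpow_one] using h

lemma inverse_sq_substitution {s C x : ℝ} (hx : 0 < x) :
    (|(-2 : ℝ)| * x ^ ((-2 : ℝ) - 1)) • ((x ^ (-2 : ℝ)) ^ (s - 1) * Real.exp (-(C * x ^ (-2 : ℝ))))
      = 2 * x ^ (-2 * s - 1) * Real.exp (-C / x ^ 2) := by
  have h1 : x ^ (-2 * s - 1) = x ^ ((-2 : ℝ) - 1) * x ^ (-2 * (s - 1)) := by
    rw [← Real.rpow_add hx]; ring_nf
  have h2 : -C / x ^ 2 = -(C * x ^ (-2 : ℝ)) := by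
    rw [Real.rpow_neg hx.le, Real.rpow_two]; ring
  rw [h1, h2, ← Real.rpow_mul hx.le, abs_neg, abs_two, smul_eq_mul]
  ring

lemma integrableOn_inverse_gamma {s C : ℝ} (hs : 0 < s) (hC : 0 < C) :
    IntegrableOn (fun x : ℝ => 2 * x ^ (-2 * s - 1) * Real.exp (-C / x ^ 2)) (Ioi 0) :=
  ((integrableOn_Ioi_comp_rpow_iff _ (by norm_num : (-2 : ℝ) ≠ 0)).2
    (integrableOn_rpow_mul_exp_neg_mul hs hC)).congr_fun
    (fun _ hx => inverse_sq_substitution hx) measurableSet_Ioi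

lemma integral_inverse_gamma {s C : ℝ} (hs : 0 < s) (hC : 0 < C) :
    ∫ x in Ioi (0 : ℝ), 2 * x ^ (-2 * s - 1) * Real.exp (-C / x ^ 2)
      = Real.Gamma s * C ^ (-s) := by
  rw [← setIntegral_congr_fun measurableSet_Ioi (fun _ hx => inverse_sq_substitution hx),
    integral_comp_rpow_Ioi (fun t => t ^ (s - 1) * Real.exp (-(C * t)))
      (by norm_num : (-2 : ℝ) ≠ 0),
    Real.integral_rpow_mul_exp_neg_mul_Ioi hs hC, one_div, Real.inv_rpow hC.le,
    Real.rpow_neg hC.le, mul_comm]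

lemma integral_tsum_inverse_gamma {C : ℝ} (hC : 0 < C) {c s : ℕ → ℝ} (hc : ∀ i, 0 ≤ c i)
    (hs : ∀ i, 0 < s i) (hsum : Summable fun i => c i * (Real.Gamma (s i) * C ^ (-s i))) :
    ∫ x in Ioi (0 : ℝ), ∑' i, c i * (2 * x ^ (-2 * s i - 1) * Real.exp (-C / x ^ 2))
      = ∑' i, c i * (Real.Gamma (s i) * C ^ (-s i)) := by
  have hval : ∀ i, ∫ x in Ioi (0 : ℝ), c i * (2 * x ^ (-2 * s i - 1) * Real.exp (-C / x ^ 2))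
      = c i * (Real.Gamma (s i) * C ^ (-s i)) := fun i => by
    rw [integral_const_mul, integral_inverse_gamma (hs i) hC]
  have hnorm : ∀ i, ∫ x in Ioi (0 : ℝ), ‖c i * (2 * x ^ (-2 * s i - 1) * Real.exp (-C / x ^ 2))‖
      = c i * (Real.Gamma (s i) * C ^ (-s i)) := fun i => by
    rw [← hval i]
    refine setIntegral_congr_fun measurableSet_Ioi fun x hx => Real.norm_of_nonneg ?_
    have := hc i
    have : (0 : ℝ) < x := hx
    positivity
  rw [← (hasSum_integral_of_summable_integral_norm
    (fun i => (integrableOn_inverse_gamma (hs i) hC).const_mul (c i))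
    (by simpa only [hnorm] using hsum)).tsum_eq]
  exact tsum_congr hval

lemma integrableOn_gamma_mul_shift {a s m l B : ℝ} (ha : 0 < a) (hs : 0 < s) (hm : 0 < m)
    (hl : 0 < l) (hB : 0 < B) :
    IntegrableOn (fun u : ℝ => u ^ (a - 1) * Real.exp (-(m * u)) * (l * u + B) ^ (-s)) (Ioi 0) := by
  refine ((integrableOn_rpow_mul_exp_neg_mul ha hm).mul_const (B ^ (-s))).mono'
    (by fun_prop) ?_
  filter_upwards [ae_restrict_mem measurableSet_Ioi] with u hu
  have hu : (0 : ℝ) < u := hu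
  rw [Real.norm_of_nonneg (by positivity)]
  gcongr ?_ * ?_
  exact Real.rpow_le_rpow_of_nonpos hB (by nlinarith [mul_pos hl hu]) (by linarith)

lemma gamma_mul_integral_gamma_mul_shift {a s m l B : ℝ} (ha : 0 < a) (hs : 0 < s) (hm : 0 < m)
    (hl : 0 < l) (hB : 0 < B) :
    Real.Gamma s * ∫ u in Ioi (0 : ℝ), u ^ (a - 1) * Real.exp (-(m * u)) * (l * u + B) ^ (-s)
      = Real.Gamma a * ∫ x in Ioi (0 : ℝ), x ^ (s - 1) * Real.exp (-(B * x)) *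
        (l * x + m) ^ (-a) := by
  let f : ℝ → ℝ → ℝ := fun u x =>
    u ^ (a - 1) * Real.exp (-(m * u)) * (x ^ (s - 1) * Real.exp (-((l * u + B) * x)))
  have hf1 : ∀ u ∈ Ioi (0 : ℝ), ∫ x in Ioi (0 : ℝ), f u x
      = Real.Gamma s * (u ^ (a - 1) * Real.exp (-(m * u)) * (l * u + B) ^ (-s)) := fun u hu => by
    have hu : (0 : ℝ) < u := hu
    have hp : 0 < l * u + B := by positivity
    simp only [f]
    rw [integral_const_mul, Real.integral_rpow_mul_exp_neg_mul_Ioi hs hp, one_div,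
      Real.inv_rpow hp.le, Real.rpow_neg hp.le]
    ring
  have hf2 : ∀ x ∈ Ioi (0 : ℝ), ∫ u in Ioi (0 : ℝ), f u x
      = Real.Gamma a * (x ^ (s - 1) * Real.exp (-(B * x)) * (l * x + m) ^ (-a)) := fun x hx => by
    have hx : (0 : ℝ) < x := hx
    have hp : 0 < l * x + m := by positivity
    have he : ∀ u, f u x = x ^ (s - 1) * Real.exp (-(B * x)) *
        (u ^ (a - 1) * Real.exp (-((l * x + m) * u))) := fun u => by
      have : Real.exp (-(m * u)) * Real.exp (-((l * u + B) * x))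
          = Real.exp (-(B * x)) * Real.exp (-((l * x + m) * u)) := by
        rw [← Real.exp_add, ← Real.exp_add]; ring_nf
      simp only [f]
      linear_combination u ^ (a - 1) * x ^ (s - 1) * this
    simp only [he]
    rw [integral_const_mul, Real.integral_rpow_mul_exp_neg_mul_Ioi ha hp, one_div,
      Real.inv_rpow hp.le, Real.rpow_neg hp.le]
    ring
  have hmeas : AEStronglyMeasurable (Function.uncurry f)
      ((volume.restrict (Ioi 0)).prod (volume.restrict (Ioi 0))) := by
    refine Measurable.aestronglyMeasurable ?_
    simp only [f, Function.uncurry_def]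
    fun_prop
  have hint : Integrable (Function.uncurry f)
      ((volume.restrict (Ioi 0)).prod (volume.restrict (Ioi 0))) := by
    rw [integrable_prod_iff hmeas]
    constructor
    · filter_upwards [ae_restrict_mem measurableSet_Ioi] with u hu
      have hu : (0 : ℝ) < u := hu
      exact Integrable.const_mul
        (integrableOn_rpow_mul_exp_neg_mul hs (by positivity : 0 < l * u + B))
        (u ^ (a - 1) * Real.exp (-(m * u)))
    · refine ((integrableOn_gamma_mul_shift ha hs hm hl hB).const_mul (Real.Gamma s)).congr ?_
      filter_upwards [ae_restrict_mem measurableSet_Ioi] with u hu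
      rw [← hf1 u hu]
      refine setIntegral_congr_fun measurableSet_Ioi fun x hx => (Real.norm_of_nonneg ?_).symm
      have hu : (0 : ℝ) < u := hu
      have hx : (0 : ℝ) < x := hx
      simp only [f]
      positivity
  have := integral_integral_swap hint
  rwa [setIntegral_congr_fun measurableSet_Ioi hf1, setIntegral_congr_fun measurableSet_Ioi hf2,
    integral_const_mul, integral_const_mul] at this

lemma integral_gamma_mul_shift {a s m l B : ℝ} (ha : 0 < a) (hs : 0 < s) (hm : 0 < m)
    (hl : 0 < l) (hB : 0 < B) :
    ∫ u in Ioi (0 : ℝ), u ^ (a - 1) * Real.exp (-(m * u)) * (l * u + B) ^ (-s)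
      = Real.Gamma a * (m / l) ^ s * m ^ (-a) * tricomiU s (1 + s - a) (m * B / l) := by
  have hk : 0 < m / l := by positivity
  have hpt : ∀ y ∈ Ioi (0 : ℝ), Real.exp (-(m * B / l) * y) * y ^ (s - 1) *
      (1 + y) ^ (1 + s - a - s - 1) = m ^ a * (m / l) ^ (1 - s) *
      ((m / l * y) ^ (s - 1) * Real.exp (-(B * (m / l * y))) * (l * (m / l * y) + m) ^ (-a)) :=
    fun y hy => by
    have hy : (0 : ℝ) < y := hy
    have e1 : l * (m / l * y) + m = m * (1 + y) := by field_simp; ring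
    have e2 : -(m * B / l) * y = -(B * (m / l * y)) := by ring
    have e3 : (m / l) ^ (1 - s) * (m / l) ^ (s - 1) = 1 := by
      rw [← Real.rpow_add hk]; simp
    have e4 : m ^ a * m ^ (-a) = 1 := by rw [← Real.rpow_add hm]; simp
    rw [e1, e2, Real.mul_rpow hk.le hy.le, Real.mul_rpow hm.le (by positivity),
      show 1 + s - a - s - 1 = -a by ring]
    have e5 : (m / l) ^ (1 - s) * (m / l) ^ (s - 1) * (m ^ a * m ^ (-a)) = 1 := by
      rw [e3, e4, mul_one]
    linear_combination
      -(Real.exp (-(B * (m / l * y))) * y ^ (s - 1) * (1 + y) ^ (-a)) * e5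
  have hG := (Real.Gamma_pos_of_pos hs).ne'
  have h1 := gamma_mul_integral_gamma_mul_shift ha hs hm hl hB
  rw [tricomiU, setIntegral_congr_fun measurableSet_Ioi hpt, integral_const_mul,
    integral_comp_mul_left_Ioi
      (fun x => x ^ (s - 1) * Real.exp (-(B * x)) * (l * x + m) ^ (-a)) 0 hk, mul_zero,
    smul_eq_mul]
  have e3 : (m / l) ^ s * (m / l) ^ (1 - s) * (m / l)⁻¹ = 1 := by
    rw [← Real.rpow_add hk, ← Real.rpow_neg_one, ← Real.rpow_add hk]; simp
  have e4 : m ^ a * m ^ (-a) = 1 := by rw [← Real.rpow_add hm]; simp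
  apply mul_left_cancel₀ hG
  rw [h1]
  generalize (∫ x in Ioi (0 : ℝ), x ^ (s - 1) * Real.exp (-(B * x)) * (l * x + m) ^ (-a)) = J
  calc Real.Gamma a * J = Real.Gamma s * (1 / Real.Gamma s) * 1 * 1 * (Real.Gamma a * J) := by
        field_simp
    _ = _ := by
        nth_rewrite 1 [← e3]
        rw [← e4]; ring

lemma sq_substitution {a s m l B x : ℝ} (hx : 0 < x) :
    (|(2 : ℝ)| * x ^ ((2 : ℝ) - 1)) • ((x ^ (2 : ℝ)) ^ (a - 1) * Real.exp (-(m * x ^ (2 : ℝ))) *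
        (l * x ^ (2 : ℝ) + B) ^ (-s))
      = 2 * x ^ (2 * a - 1) * Real.exp (-m * x ^ 2) * (l * x ^ 2 + B) ^ (-s) := by
  have h1 : x ^ (2 * a - 1) = x ^ ((2 : ℝ) - 1) * x ^ (2 * (a - 1)) := by
    rw [← Real.rpow_add hx]; ring_nf
  rw [h1, ← Real.rpow_mul hx.le, abs_two, smul_eq_mul, Real.rpow_two, neg_mul]
  ring

lemma integrableOn_nakagami_mul_shift {a s m l B : ℝ} (ha : 0 < a) (hs : 0 < s) (hm : 0 < m)
    (hl : 0 < l) (hB : 0 < B) :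
    IntegrableOn (fun x : ℝ => 2 * x ^ (2 * a - 1) * Real.exp (-m * x ^ 2) *
      (l * x ^ 2 + B) ^ (-s)) (Ioi 0) :=
  ((integrableOn_Ioi_comp_rpow_iff _ (two_ne_zero' ℝ)).2
    (integrableOn_gamma_mul_shift ha hs hm hl hB)).congr_fun
    (fun _ hx => sq_substitution hx) measurableSet_Ioi

lemma integral_nakagami_mul_shift {a s m l B : ℝ} (ha : 0 < a) (hs : 0 < s) (hm : 0 < m)
    (hl : 0 < l) (hB : 0 < B) :
    ∫ x in Ioi (0 : ℝ), 2 * x ^ (2 * a - 1) * Real.exp (-m * x ^ 2) * (l * x ^ 2 + B) ^ (-s)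
      = Real.Gamma a * (m / l) ^ s * m ^ (-a) * tricomiU s (1 + s - a) (m * B / l) := by
  rw [← setIntegral_congr_fun measurableSet_Ioi (fun _ hx => sq_substitution hx),
    integral_comp_rpow_Ioi
      (fun u => u ^ (a - 1) * Real.exp (-(m * u)) * (l * u + B) ^ (-s)) (two_ne_zero' ℝ),
    integral_gamma_mul_shift ha hs hm hl hB]

lemma integrableOn_nakagami {a m : ℝ} (ha : 0 < a) (hm : 0 < m) :
    IntegrableOn (fun x : ℝ => 2 * x ^ (2 * a - 1) * Real.exp (-m * x ^ 2)) (Ioi 0) := by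
  refine IntegrableOn.congr_fun (Integrable.const_mul (integrableOn_rpow_mul_exp_neg_mul_rpow
    (p := 2) (s := 2 * a - 1) (b := m) (by linarith) two_pos hm) 2) (fun x _ => ?_)
    measurableSet_Ioi
  simp only [Real.rpow_two]
  ring

lemma four_pow_mul_poch_mul_poch {x : ℝ} (hx : 0 < x) (i : ℕ) :
    2 ^ (2 * i) * poch (x / 2) i * poch ((1 + x) / 2) i * Real.Gamma x
      = Real.Gamma (x + 2 * i) := by
  have h0 := Real.Gamma_mul_Gamma_add_half (x / 2)
  have h1 := Real.Gamma_mul_Gamma_add_half (x / 2 + i)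
  have g1 : 0 < Real.Gamma (x / 2) := Real.Gamma_pos_of_pos (by positivity)
  have g2 : 0 < Real.Gamma ((1 + x) / 2) := Real.Gamma_pos_of_pos (by positivity)
  rw [show x / 2 + 1 / 2 = (1 + x) / 2 by ring, show 2 * (x / 2) = x by ring] at h0
  rw [show x / 2 + i + 1 / 2 = (1 + x) / 2 + i by ring,
    show 2 * (x / 2 + i) = x + 2 * i by ring] at h1
  have hpow : (2 : ℝ) ^ (1 - x) = 2 ^ (2 * i) * 2 ^ (1 - (x + 2 * i)) := by
    rw [← Real.rpow_natCast, ← Real.rpow_add two_pos]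
    push_cast
    ring_nf
  rw [hpow] at h0
  have p1 : (0 : ℝ) < 2 ^ (1 - (x + 2 * (i : ℝ))) := by positivity
  have p2 : 0 < √Real.pi := Real.sqrt_pos.2 Real.pi_pos
  unfold poch
  have hne : (2 : ℝ) ^ (1 - (x + 2 * (i : ℝ))) * √Real.pi ≠ 0 := by positivity
  apply mul_right_cancel₀ hne
  rw [← mul_assoc (Real.Gamma (x + 2 * i)), ← h1]
  field_simp
  linear_combination -h0

lemma summable_gamma_ratio_mul_pow {x y q : ℝ} (hx : 0 < x) (hy : 0 < y) (hq : 0 < q)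
    (hq1 : 4 * q < 1) :
    Summable fun i : ℕ => Real.Gamma (x + 2 * i) / (i.factorial * Real.Gamma (y + i)) * q ^ i := by
  have hG : ∀ {z : ℝ}, 0 < z → 0 < Real.Gamma z := Real.Gamma_pos_of_pos
  have hpos : ∀ i : ℕ,
      0 < Real.Gamma (x + 2 * i) / (i.factorial * Real.Gamma (y + i)) * q ^ i := fun i => by
    have := hG (show 0 < x + 2 * (i : ℝ) by positivity)
    have := hG (show 0 < y + (i : ℝ) by positivity)
    positivity
  refine summable_of_ratio_test_tendsto_lt_one hq1 (.of_forall fun i => (hpos i).ne') ?_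
  have hlim := ((tendsto_add_mul_div_add_mul_atTop_nhds x 1 2 (one_ne_zero' ℝ)).mul
    (tendsto_add_mul_div_add_mul_atTop_nhds (x + 1) y 2 (one_ne_zero' ℝ))).mul_const q
  rw [show (2 : ℝ) / 1 * (2 / 1) * q = 4 * q by ring] at hlim
  refine hlim.congr fun i => ?_
  rw [Real.norm_of_nonneg (hpos _).le, Real.norm_of_nonneg (hpos _).le]
  have e1 : Real.Gamma (x + 2 * ((i + 1 : ℕ) : ℝ))
      = (x + 1 + 2 * i) * ((x + 2 * i) * Real.Gamma (x + 2 * i)) := by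
    rw [← Real.Gamma_add_one (by positivity), show x + 1 + 2 * (i : ℝ) = x + 2 * i + 1 by ring,
      ← Real.Gamma_add_one (by positivity)]
    push_cast
    ring_nf
  have e2 : Real.Gamma (y + ((i + 1 : ℕ) : ℝ)) = (y + i) * Real.Gamma (y + i) := by
    rw [← Real.Gamma_add_one (by positivity)]
    push_cast
    ring_nf
  have g1 := hG (show 0 < x + 2 * (i : ℝ) by positivity)
  have g2 := hG (show 0 < y + (i : ℝ) by positivity)
  rw [e1, e2, Nat.factorial_succ, pow_succ]
  push_cast
  field_simp
  ring

lemma nakagami_mul_shift_le {a s m l x c b : ℝ} (hs : 0 < s) (hl : 0 < l) (hx : 0 < x)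
    (hc : 0 < c) (hb : 0 < b) (i : ℕ) :
    (x * l) ^ i * (2 * b ^ (2 * (a + i) - 1) * Real.exp (-m * b ^ 2) *
        (l * b ^ 2 + (x + c)) ^ (-(s + 2 * i)))
      ≤ (x / (x + c) / 4) ^ i *
        ((x + c) ^ (-s) * (2 * b ^ (2 * a - 1) * Real.exp (-m * b ^ 2))) := by
  have hC : 0 < l * b ^ 2 + (x + c) := by positivity
  have h1 : b ^ (2 * (a + i) - 1) = b ^ (2 * a - 1) * (b ^ 2) ^ i := by
    rw [← pow_mul, ← Real.rpow_natCast b (2 * i), ← Real.rpow_add hb]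
    push_cast
    ring_nf
  have h2 : (l * b ^ 2 + (x + c)) ^ (-(s + 2 * i))
      = (l * b ^ 2 + (x + c)) ^ (-s) * (((l * b ^ 2 + (x + c)) ^ 2)⁻¹) ^ i := by
    rw [inv_pow, ← pow_mul, ← Real.rpow_natCast _ (2 * i), ← Real.rpow_neg hC.le,
      ← Real.rpow_add hC]
    push_cast
    ring_nf
  have h3 : (l * b ^ 2 + (x + c)) ^ (-s) ≤ (x + c) ^ (-s) :=
    Real.rpow_le_rpow_of_nonpos (by positivity) (by nlinarith [mul_pos hl (pow_pos hb 2)])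
      (by linarith)
  have h4 : x * l * b ^ 2 * ((l * b ^ 2 + (x + c)) ^ 2)⁻¹ ≤ x / (x + c) / 4 := by
    rw [← div_eq_mul_inv, div_div, div_le_div_iff₀ (by positivity) (by positivity)]
    nlinarith [mul_nonneg hx.le (sq_nonneg (l * b ^ 2 - (x + c)))]
  rw [h1, h2]
  calc _ = (x * l * b ^ 2 * ((l * b ^ 2 + (x + c)) ^ 2)⁻¹) ^ i *
        ((l * b ^ 2 + (x + c)) ^ (-s) * (2 * b ^ (2 * a - 1) * Real.exp (-m * b ^ 2))) := by
        simp only [mul_pow]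
        ring
    _ ≤ _ := by gcongr

lemma summable_gamma_ratio_mul_pow_div {s y x c : ℝ} (hs : 0 < s) (hy : 0 < y) (hx : 0 < x)
    (hc : 0 < c) :
    Summable fun i : ℕ => Real.Gamma (s + 2 * i) / (i.factorial * Real.Gamma (y + i)) *
      (x / (x + c) / 4) ^ i := by
  refine summable_gamma_ratio_mul_pow hs hy (by positivity) ?_
  rw [mul_div_cancel₀ _ (four_ne_zero' ℝ), div_lt_one (by positivity)]
  linarith

lemma gamma_ratio_nonneg {s y : ℝ} (hs : 0 < s) (hy : 0 < y) (i : ℕ) :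
    0 ≤ Real.Gamma (s + 2 * i) / (i.factorial * Real.Gamma (y + i)) :=
  div_nonneg (Real.Gamma_nonneg_of_nonneg (by positivity))
    (mul_nonneg (by positivity) (Real.Gamma_nonneg_of_nonneg (by positivity)))

lemma summable_gamma_ratio_mul_nakagami {s y a m l x c b : ℝ} (hs : 0 < s) (hy : 0 < y)
    (hl : 0 < l) (hx : 0 < x) (hc : 0 < c) (hb : 0 < b) :
    Summable fun i : ℕ => Real.Gamma (s + 2 * i) / (i.factorial * Real.Gamma (y + i)) *
      ((x * l) ^ i * (2 * b ^ (2 * (a + i) - 1) * Real.exp (-m * b ^ 2) *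
        (l * b ^ 2 + (x + c)) ^ (-(s + 2 * i)))) := by
  refine Summable.of_nonneg_of_le (fun i => mul_nonneg (gamma_ratio_nonneg hs hy i)
    (by positivity)) (fun i => ?_) ((summable_gamma_ratio_mul_pow_div hs hy hx hc).mul_right
      ((x + c) ^ (-s) * (2 * b ^ (2 * a - 1) * Real.exp (-m * b ^ 2))))
  exact (mul_le_mul_of_nonneg_left (nakagami_mul_shift_le hs hl hx hc hb i)
    (gamma_ratio_nonneg hs hy i)).trans_eq (mul_assoc _ _ _).symm

lemma integral_tsum_nakagami {s y a m l x c : ℝ} (hs : 0 < s) (hy : 0 < y) (ha : 0 < a)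
    (hm : 0 < m) (hl : 0 < l) (hx : 0 < x) (hc : 0 < c) :
    ∫ b in Ioi (0 : ℝ), ∑' i : ℕ, Real.Gamma (s + 2 * i) / (i.factorial * Real.Gamma (y + i)) *
      ((x * l) ^ i * (2 * b ^ (2 * (a + i) - 1) * Real.exp (-m * b ^ 2) *
        (l * b ^ 2 + (x + c)) ^ (-(s + 2 * i))))
      = ∑' i : ℕ, Real.Gamma (s + 2 * i) / (i.factorial * Real.Gamma (y + i)) *
        ((x * l) ^ i * (Real.Gamma (a + i) * (m / l) ^ (s + 2 * i) * m ^ (-(a + i)) *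
          tricomiU (s + 2 * i) (1 + (s + 2 * i) - (a + i)) (m * (x + c) / l))) := by
  have hB : 0 < x + c := by positivity
  have hint : ∀ i : ℕ, IntegrableOn (fun b : ℝ =>
      Real.Gamma (s + 2 * i) / (i.factorial * Real.Gamma (y + i)) *
      ((x * l) ^ i * (2 * b ^ (2 * (a + i) - 1) * Real.exp (-m * b ^ 2) *
        (l * b ^ 2 + (x + c)) ^ (-(s + 2 * i))))) (Ioi 0) := fun i =>
    ((integrableOn_nakagami_mul_shift (by positivity) (by positivity) hm hl hB).const_mul
      _).const_mul _
  have hsum : Summable fun i : ℕ => ∫ b in Ioi (0 : ℝ),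
      ‖Real.Gamma (s + 2 * i) / (i.factorial * Real.Gamma (y + i)) *
      ((x * l) ^ i * (2 * b ^ (2 * (a + i) - 1) * Real.exp (-m * b ^ 2) *
        (l * b ^ 2 + (x + c)) ^ (-(s + 2 * i))))‖ := by
    refine Summable.of_nonneg_of_le (fun i => integral_nonneg fun _ => norm_nonneg _)
      (fun i => ?_) ((summable_gamma_ratio_mul_pow_div hs hy hx hc).mul_right
        (∫ b in Ioi (0 : ℝ),
          (x + c) ^ (-s) * (2 * b ^ (2 * a - 1) * Real.exp (-m * b ^ 2))))
    rw [← integral_const_mul]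
    refine setIntegral_mono_on (hint i).norm
      (((integrableOn_nakagami ha hm).const_mul _).const_mul _) measurableSet_Ioi fun b hb => ?_
    have hb : (0 : ℝ) < b := hb
    rw [Real.norm_of_nonneg (mul_nonneg (gamma_ratio_nonneg hs hy i) (by positivity))]
    exact (mul_le_mul_of_nonneg_left (nakagami_mul_shift_le hs hl hx hc hb i)
      (gamma_ratio_nonneg hs hy i)).trans_eq (mul_assoc _ _ _).symm
  rw [← (hasSum_integral_of_summable_integral_norm hint hsum).tsum_eq]
  refine tsum_congr fun i => ?_
  rw [integral_const_mul, integral_const_mul,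
    integral_nakagami_mul_shift (by positivity) (by positivity) hm hl hB]

lemma exists_eq_exp {x : ℝ} (hx : 0 < x) : ∃ y, x = Real.exp y :=
  ⟨Real.log x, (Real.exp_log hx).symm⟩

lemma kappa_mu_power_identity {μ ms r v b α : ℝ} (hr : 0 < r) (hv : 0 < v) (hb : 0 < b)
    (hα : 0 < α) (i : ℕ) :
    r ^ μ / (v * α ^ 2 * b ^ (μ - 1)) * (b * r / (v * α ^ 2)) ^ (μ - 1 + 2 * (i : ℝ)) *
        α ^ (-2 * ms - 1)
      = (1 / v) ^ μ * r ^ (2 * μ - 1) * (r ^ 2 * b ^ 2 / v ^ 2) ^ i *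
        α ^ (-2 * (μ + ms + 2 * i) - 1) := by
  obtain ⟨r, rfl⟩ := exists_eq_exp hr
  obtain ⟨v, rfl⟩ := exists_eq_exp hv
  obtain ⟨b, rfl⟩ := exists_eq_exp hb
  obtain ⟨α, rfl⟩ := exists_eq_exp hα
  simp only [one_div, ← Real.exp_mul, ← Real.exp_nat_mul, ← Real.exp_add, ← Real.exp_sub,
    ← Real.exp_neg]
  congr 1
  push_cast
  ring

lemma nakagami_power_identity {p q n m μ η κ r rhat : ℝ} (hμ : 0 < μ) (hm : 0 < m) (hη : 0 < η)
    (hκ : 0 < κ) (hr : 0 < r) (hrhat : 0 < rhat) (i : ℕ) :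
    (μ * η / rhat ^ 2) ^ p * m ^ n * ((μ * η / rhat ^ 2 * r ^ 2 * (μ * κ)) ^ i *
        ((m / (μ * κ)) ^ (p + q + 2 * (i : ℝ)) * m ^ (-(n + i))))
      = m ^ (q + p) * η ^ p / (κ ^ (q + p) * μ ^ q * rhat ^ (2 * p)) *
        (m * η * r ^ 2 / (rhat ^ 2 * κ)) ^ i := by
  obtain ⟨μ, rfl⟩ := exists_eq_exp hμ
  obtain ⟨m, rfl⟩ := exists_eq_exp hm
  obtain ⟨η, rfl⟩ := exists_eq_exp hη
  obtain ⟨κ, rfl⟩ := exists_eq_exp hκ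
  obtain ⟨r, rfl⟩ := exists_eq_exp hr
  obtain ⟨rhat, rfl⟩ := exists_eq_exp hrhat
  simp only [← Real.exp_mul, ← Real.exp_nat_mul, ← Real.exp_add, ← Real.exp_sub]
  congr 1
  push_cast
  ring

/-- Theorem 7: PDF of the double shadowed κ-μ Type II model, example 1. -/
theorem double_shadowed_typeII_example1_pdf
    (κ μ md ms rhat r σ d θ₁ θ₂ : ℝ)
    (hκ : 0 < κ) (hμ : 0 < μ) (hmd : 0 < md) (hrhat : 0 < rhat) (hms : 1 < ms)
    (hr : 0 < r)
    (hσ : σ = rhat / Real.sqrt (2 * μ * (1 + κ)))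
    (hd : d = σ * Real.sqrt (2 * μ * κ))
    (hθ₁ : θ₁ = (1 + ms + μ) / 2)
    (hθ₂ : θ₂ = md * ((ms - 1) * rhat ^ 2 + r ^ 2 * (1 + κ) * μ) / (rhat ^ 2 * κ * μ)) :
    (∫ β in Ioi (0 : ℝ), ∫ α in Ioi (0 : ℝ),
      (r ^ μ / (σ ^ 2 * α ^ 2 * (β * d) ^ (μ - 1))) *
        Real.exp (-(r ^ 2 + β ^ 2 * d ^ 2) / (2 * σ ^ 2 * α ^ 2)) *
        besselI (μ - 1) (β * d * r / (σ ^ 2 * α ^ 2)) *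
        (2 * (ms - 1) ^ ms * α ^ (-2 * ms - 1) *
          Real.exp (-(ms - 1) / α ^ 2) / Real.Gamma ms) *
        (2 * md ^ md * β ^ (2 * md - 1) * Real.exp (-md * β ^ 2) / Real.Gamma md)) =
    (2 * (ms - 1) ^ ms * md ^ (ms + μ) * r ^ (2 * μ - 1) * Real.Gamma (μ + ms) *
        (1 + κ) ^ μ /
        (κ ^ (ms + μ) * Real.Gamma ms * Real.Gamma md * μ ^ ms * rhat ^ (2 * μ))) *
      ∑' i : ℕ,
        (2 ^ (2 * i) * poch ((μ + ms) / 2) i * poch θ₁ i * Real.Gamma ((i : ℝ) + md) /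
            ((i.factorial : ℝ) * Real.Gamma (μ + (i : ℝ)))) *
          (md * (1 + κ) * r ^ 2 / (rhat ^ 2 * κ)) ^ (i : ℕ) *
          tricomiU (2 * (i : ℝ) + μ + ms) (1 + (i : ℝ) + μ - md + ms) θ₂ := by
  have hms0 : 0 < ms := one_pos.trans hms
  have hc : 0 < ms - 1 := by linarith
  have hη : 0 < 1 + κ := by linarith
  have hσ0 : 0 < σ := by rw [hσ]; positivity
  have hd0 : 0 < d := by rw [hd]; positivity
  have hσ2 : 2 * σ ^ 2 = rhat ^ 2 / (μ * (1 + κ)) := by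
    rw [hσ, div_pow, Real.sq_sqrt (by positivity)]
    field_simp
  have hA : 1 / (2 * σ ^ 2) = μ * (1 + κ) / rhat ^ 2 := by rw [hσ2, one_div_div]
  have hd2 : d ^ 2 / (2 * σ ^ 2) = μ * κ := by
    rw [hd, mul_pow, Real.sq_sqrt (by positivity)]
    field_simp
  set A : ℝ := μ * (1 + κ) / rhat ^ 2 with hAdef
  set l : ℝ := μ * κ with hl
  have hA0 : 0 < A := by positivity
  have hl0 : 0 < l := by positivity
  have hx : 0 < A * r ^ 2 := by positivity
  have hs : 0 < μ + ms := by positivity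
  set K : ℝ := 2 * A ^ μ * r ^ (2 * μ - 1) * (ms - 1) ^ ms * md ^ md /
    (Real.Gamma ms * Real.Gamma md) with hK
  have hGms : 0 < Real.Gamma ms := Real.Gamma_pos_of_pos hms0
  have hGmd : 0 < Real.Gamma md := Real.Gamma_pos_of_pos hmd
  have hinner : ∀ β ∈ Ioi (0 : ℝ), (∫ α in Ioi (0 : ℝ),
      (r ^ μ / (σ ^ 2 * α ^ 2 * (β * d) ^ (μ - 1))) *
        Real.exp (-(r ^ 2 + β ^ 2 * d ^ 2) / (2 * σ ^ 2 * α ^ 2)) *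
        besselI (μ - 1) (β * d * r / (σ ^ 2 * α ^ 2)) *
        (2 * (ms - 1) ^ ms * α ^ (-2 * ms - 1) *
          Real.exp (-(ms - 1) / α ^ 2) / Real.Gamma ms) *
        (2 * md ^ md * β ^ (2 * md - 1) * Real.exp (-md * β ^ 2) / Real.Gamma md)) =
      K * ∑' i : ℕ, Real.Gamma (μ + ms + 2 * i) / (i.factorial * Real.Gamma (μ + i)) *
        ((A * r ^ 2 * l) ^ i * (2 * β ^ (2 * (md + i) - 1) * Real.exp (-md * β ^ 2) *
          (l * β ^ 2 + (A * r ^ 2 + (ms - 1))) ^ (-(μ + ms + 2 * i)))) := fun β hβ => by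
    have hβ : (0 : ℝ) < β := hβ
    set C : ℝ := l * β ^ 2 + (A * r ^ 2 + (ms - 1)) with hC
    have hC0 : 0 < C := by positivity
    let c : ℕ → ℝ := fun i => K * (2 * β ^ (2 * (md + i) - 1) * Real.exp (-md * β ^ 2)) *
      (A * r ^ 2 * l) ^ i / (i.factorial * Real.Gamma (μ + i))
    have hc0 : ∀ i, 0 ≤ c i := fun i => by
      have : 0 < Real.Gamma (μ + i) := Real.Gamma_pos_of_pos (by positivity)
      positivity
    have hcG : ∀ i : ℕ, c i * (Real.Gamma (μ + ms + 2 * i) * C ^ (-(μ + ms + 2 * (i : ℝ)))) =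
        K * (Real.Gamma (μ + ms + 2 * i) / (i.factorial * Real.Gamma (μ + i)) *
        ((A * r ^ 2 * l) ^ i * (2 * β ^ (2 * (md + i) - 1) * Real.exp (-md * β ^ 2) *
          C ^ (-(μ + ms + 2 * (i : ℝ)))))) := fun i => by
      simp only [c]
      ring
    have hsum : Summable fun i : ℕ =>
        c i * (Real.Gamma (μ + ms + 2 * i) * C ^ (-(μ + ms + 2 * (i : ℝ)))) := by
      simp only [hcG]
      exact (summable_gamma_ratio_mul_nakagami hs hμ hl0 hx hc hβ).mul_left K
    rw [← tsum_mul_left, ← tsum_congr hcG,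
      ← integral_tsum_inverse_gamma hC0 hc0 (s := fun i : ℕ => μ + ms + 2 * i)
        (fun i => by positivity) hsum]
    refine setIntegral_congr_fun measurableSet_Ioi fun α hα => ?_
    have hα : (0 : ℝ) < α := hα
    have hexp : Real.exp (-(r ^ 2 + β ^ 2 * d ^ 2) / (2 * σ ^ 2 * α ^ 2)) *
        Real.exp (-(ms - 1) / α ^ 2) = Real.exp (-C / α ^ 2) := by
      rw [← Real.exp_add, hC, ← hd2, ← hA]
      congr 1
      field_simp
      ring
    simp only [besselI]
    rw [← tsum_mul_left, ← tsum_mul_right, ← tsum_mul_right]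
    refine tsum_congr fun i => ?_
    have hpow := kappa_mu_power_identity (μ := μ) (ms := ms) hr
      (show 0 < 2 * σ ^ 2 by positivity) (mul_pos hβ hd0) hα i
    have hb : β ^ (2 * (md + (i : ℝ)) - 1) = β ^ (2 * md - 1) * (β ^ 2) ^ i := by
      rw [← pow_mul, ← Real.rpow_natCast β (2 * i), ← Real.rpow_add hβ]
      push_cast
      ring_nf
    have hq : r ^ 2 * (β * d) ^ 2 / (2 * σ ^ 2) ^ 2 = A * r ^ 2 * l * β ^ 2 := by
      rw [← hA, ← hd2]
      field_simp
    rw [hA, hq, mul_pow (A * r ^ 2 * l)] at hpow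
    have e1 : β * d * r / (σ ^ 2 * α ^ 2) / 2 = β * d * r / (2 * σ ^ 2 * α ^ 2) := by
      field_simp
    have e2 : r ^ μ / (σ ^ 2 * α ^ 2 * (β * d) ^ (μ - 1))
        = 2 * (r ^ μ / (2 * σ ^ 2 * α ^ 2 * (β * d) ^ (μ - 1))) := by
      field_simp
    rw [e1, e2, show μ - 1 + (i : ℝ) + 1 = μ + i by ring]
    simp only [c, hb, hK]
    rw [← hexp]
    linear_combination (8 * Real.exp (-(r ^ 2 + β ^ 2 * d ^ 2) / (2 * σ ^ 2 * α ^ 2)) *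
      Real.exp (-(ms - 1) / α ^ 2) * (ms - 1) ^ ms * md ^ md * β ^ (2 * md - 1) *
      Real.exp (-md * β ^ 2) / (Real.Gamma ms * Real.Gamma md) /
      (i.factorial * Real.Gamma (μ + i))) * hpow
  rw [setIntegral_congr_fun measurableSet_Ioi hinner, integral_const_mul,
    integral_tsum_nakagami hs hμ hmd hmd hl0 hx hc, ← tsum_mul_left, ← tsum_mul_left]
  refine tsum_congr fun i => ?_
  have hz : md * (A * r ^ 2 + (ms - 1)) / l = θ₂ := by
    rw [hθ₂, hAdef, hl]
    field_simp
    ring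
  have hpoch := four_pow_mul_poch_mul_poch hs i
  rw [show (1 + (μ + ms)) / 2 = θ₁ by rw [hθ₁]; ring] at hpoch
  have hpow := nakagami_power_identity (p := μ) (q := ms) (n := md) hμ hmd hη hκ hr hrhat i
  rw [hz, ← hpoch, show 2 * (i : ℝ) + μ + ms = μ + ms + 2 * i by ring,
    show 1 + (i : ℝ) + μ - md + ms = 1 + (μ + ms + 2 * i) - (md + i) by ring,
    add_comm (i : ℝ) md]
  simp only [hK]
  generalize tricomiU _ _ _ = T
  linear_combination (2 * r ^ (2 * μ - 1) * (ms - 1) ^ ms / (Real.Gamma ms * Real.Gamma md) *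
    (2 ^ (2 * i) * poch ((μ + ms) / 2) i * poch θ₁ i * Real.Gamma (μ + ms)) /
    (i.factorial * Real.Gamma (μ + i)) * Real.Gamma (md + i) * T) * hpow
end
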